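/- Let n ≥ 3 and let G_unif be the superoperator of one step of the uniform random quantum circuit on n qubits for the third moment: G_unif(X) := C(n,2)^{−1} ∑_{1≤i<j≤n} ∫_{U(4)} E_{i,j}(U)^{⊗3} X (E_{i,j}(U)^{⊗3})^† dμ_H(U), acting on 2^{3n}×2^{3n} complex matrices, and let G_H(X) := ∫_{U(2^n)} V^{⊗3} X (V^{⊗3})^† dμ_H(V). Then for every integer k ≥ 0 and every matrix X, ‖G_unif^k(X) − G_H(X)‖_2 ≤ (1 − 1/(5n²))^k · ‖X‖_2, where ‖·‖_2 is the Frobenius norm. Consequently, uniform random quantum circuits of size 5n²·ln(1/ε) form an ε-approximate unitary 3-design. -/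

import Mathlib

open MeasureTheory
open scoped BigOperators Matrix

/-- Borel measurable-space structure on unitary groups of complex matrices. -/
noncomputable instance unitaryGroup.measurableSpace (m : Type*) [Fintype m] [DecidableEq m] :
    MeasurableSpace (Matrix.unitaryGroup m ℂ) := borel _

instance unitaryGroup.borelSpace (m : Type*) [Fintype m] [DecidableEq m] :
    BorelSpace (Matrix.unitaryGroup m ℂ) := ⟨rfl⟩

/-- The `t`-fold Kronecker (tensor) power of a matrix, indexed by tuples. -/
def tensorPow {α : Type*} [Fintype α] (t : ℕ) (A : Matrix α α ℂ) :
    Matrix (Fin t → α) (Fin t → α) ℂ :=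
  fun x y => ∏ a : Fin t, A (x a) (y a)

/-- The Frobenius (Hilbert-Schmidt) norm of a matrix. -/
noncomputable def frobNorm {α : Type*} [Fintype α] (M : Matrix α α ℂ) : ℝ :=
  Real.sqrt (∑ x : α, ∑ y : α, ‖M x y‖ ^ 2)

/-- `E_{i,j}(U)`: the two-qubit gate `U ∈ U(4)` applied to qubits `i` and `j` of `n` qubits,
acting as the identity elsewhere. -/
def pairGate (n : ℕ) (i j : Fin n)
    (U : Matrix (Fin 2 × Fin 2) (Fin 2 × Fin 2) ℂ) :
    Matrix (Fin n → Fin 2) (Fin n → Fin 2) ℂ :=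
  fun x y => U (x i, x j) (y i, y j) *
    ∏ k ∈ Finset.univ.filter fun k => k ≠ i ∧ k ≠ j, (if x k = y k then (1 : ℂ) else 0)

/-- One step of the uniform random quantum circuit on `n` qubits, for the third moment:
`G_unif(X) = C(n,2)⁻¹ ∑_{i<j} ∫ E_{i,j}(U)^{⊗3} X (E_{i,j}(U)^{⊗3})† dμ(U)` (entrywise). -/
noncomputable def uniformStep (n : ℕ)
    (μ : Measure (Matrix.unitaryGroup (Fin 2 × Fin 2) ℂ))
    (X : Matrix (Fin 3 → Fin n → Fin 2) (Fin 3 → Fin n → Fin 2) ℂ) :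
    Matrix (Fin 3 → Fin n → Fin 2) (Fin 3 → Fin n → Fin 2) ℂ :=
  fun x y => ((n.choose 2 : ℂ))⁻¹ *
    ∑ p ∈ Finset.univ.filter fun p : Fin n × Fin n => p.1 < p.2,
      ∫ U : Matrix.unitaryGroup (Fin 2 × Fin 2) ℂ,
        (tensorPow 3 (pairGate n p.1 p.2 (U : Matrix (Fin 2 × Fin 2) (Fin 2 × Fin 2) ℂ)) * X *
          (tensorPow 3
            (pairGate n p.1 p.2 (U : Matrix (Fin 2 × Fin 2) (Fin 2 × Fin 2) ℂ)))ᴴ) x y ∂μ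

/-- The Haar third-moment superoperator on `n` qubits (entrywise). -/
noncomputable def haarStep (n : ℕ)
    (μH : Measure (Matrix.unitaryGroup (Fin n → Fin 2) ℂ))
    (X : Matrix (Fin 3 → Fin n → Fin 2) (Fin 3 → Fin n → Fin 2) ℂ) :
    Matrix (Fin 3 → Fin n → Fin 2) (Fin 3 → Fin n → Fin 2) ℂ :=
  fun x y =>
    ∫ V : Matrix.unitaryGroup (Fin n → Fin 2) ℂ,
      (tensorPow 3 (V : Matrix (Fin n → Fin 2) (Fin n → Fin 2) ℂ) * X *
        (tensorPow 3 (V : Matrix (Fin n → Fin 2) (Fin n → Fin 2) ℂ))ᴴ) x y ∂μH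


section Abstract

variable {E : Type*} [NormedAddCommGroup E] [InnerProductSpace ℂ E]

/-- Knabe-type combinatorial inequality on the complete graph. -/
theorem knabe_sum {n : ℕ} (a : Fin n → Fin n → E)
    (h0 : ∀ i, a i i = 0) (hsymm : ∀ i j, a i j = a j i)
    (htri : ∀ i j k, i ≠ j → j ≠ k → i ≠ k →
      0 ≤ RCLike.re (inner ℂ (a i j) (a j k)) + RCLike.re (inner ℂ (a j k) (a i k))
        + RCLike.re (inner ℂ (a i j) (a i k)))
    (hdis : ∀ i j k l, i ≠ j → k ≠ l → i ≠ k → i ≠ l → j ≠ k → j ≠ l →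
      0 ≤ RCLike.re (inner ℂ (a i j) (a k l))) :
    2 * ∑ i, ∑ j, ‖a i j‖ ^ 2 ≤ ‖∑ i, ∑ j, a i j‖ ^ 2 := by
  classical
  set G : Fin n → Fin n → Fin n → Fin n → ℝ :=
    fun i j k l => RCLike.re (inner ℂ (a i j) (a k l)) with hG
  have hGs : ∀ i j k l, G i j k l = G k l i j := by
    intro i j k l
    simp only [hG]
    rw [← inner_conj_symm, RCLike.conj_re]
  have hexp : ‖∑ i, ∑ j, a i j‖ ^ 2 = ∑ i, ∑ j, ∑ k, ∑ l, G i j k l := by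
    rw [← inner_self_eq_norm_sq (𝕜 := ℂ)]
    simp only [hG]
    rw [sum_inner, map_sum]
    refine Finset.sum_congr rfl fun i _ => ?_
    rw [sum_inner, map_sum]
    refine Finset.sum_congr rfl fun j _ => ?_
    simp only [inner_sum, map_sum]
  have hdiag : ∀ i j, G i j i j = ‖a i j‖ ^ 2 := by
    intro i j
    simp only [hG]
    rw [inner_self_eq_norm_sq (𝕜 := ℂ)]
  have hz1 : ∀ i k l, G i i k l = 0 := by intro i k l; simp [hG, h0]
  have hz2 : ∀ i j k, G i j k k = 0 := by intro i j k; simp [hG, h0]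
  have hs1 : ∀ i j k l, G i j k l = G j i k l := by
    intro i j k l; simp only [hG, hsymm i j]
  have hs2 : ∀ i j k l, G i j k l = G i j l k := by
    intro i j k l; simp only [hG, hsymm k l]
  set B : Fin n → Fin n → Fin n → ℝ := fun i j l => if l = j then 0 else G i j i l with hB
  have hpt : ∀ i j k l, (if k = i then B i j l else 0) + (if k = j then B j i l else 0)
      + (if l = i then B i j k else 0) + (if l = j then B j i k else 0)
      + (if k = i then (if l = j then G i j i j else 0) else 0)
      + (if k = j then (if l = i then G i j i j else 0) else 0) ≤ G i j k l := by
    intro i j k l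
    by_cases hij : i = j
    · subst hij; simp [hB, hz1]
    by_cases hkl : k = l
    · subst hkl
      by_cases h1 : k = i
      · subst h1
        have := hij
        simp [hB, hz2, hij]
      · by_cases h2 : k = j
        · subst h2; simp [hB, hz2, hij, h1]
        · simp [h1, h2, hz2]
    by_cases h1 : k = i
    · subst h1
      have hlk : ¬ l = k := fun h => hkl h.symm
      by_cases h2 : l = j
      · subst h2; simp [hB, hij, hlk]
      · simp [hB, hij, h2, hlk]
    · by_cases h2 : k = j
      · subst h2
        have hlk : ¬ l = k := fun h => hkl h.symm
        by_cases h3 : l = i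
        · subst h3
          have : ¬ k = l := h1
          simp [hB, hlk, this]
          rw [hs2]
        · simp [hB, h1, h3, hlk]
          rw [hs1]
      · by_cases h3 : l = i
        · subst h3
          simp [hB, h1, h2, hij]
          rw [hs2 l j k l]
        · by_cases h4 : l = j
          · subst h4
            simp [hB, h1, h2, h3]
            rw [hs1 l i, hs2 i l l k]
          · simp [h1, h2, h3, h4]
            exact hdis i j k l hij hkl (Ne.symm h1) (Ne.symm h3) (Ne.symm h2) (Ne.symm h4)
  have hsum := Finset.sum_le_sum fun i (_ : i ∈ Finset.univ) =>
    Finset.sum_le_sum fun j (_ : j ∈ Finset.univ) =>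
    Finset.sum_le_sum fun k (_ : k ∈ Finset.univ) =>
    Finset.sum_le_sum fun l (_ : l ∈ Finset.univ) => hpt i j k l
  have hBsum : 0 ≤ ∑ i, ∑ j, ∑ l, B i j l := by
    have e1 : ∑ i, ∑ j, ∑ l, B i j l = ∑ i, ∑ j, ∑ l, B j i l := by
      rw [Finset.sum_comm]
    have e2 : ∑ i, ∑ j, ∑ l, B i j l = ∑ i, ∑ j, ∑ l, B l j i := by
      rw [Finset.sum_comm]
      rw [Finset.sum_congr rfl fun k _ => Finset.sum_comm]
      rw [Finset.sum_comm]
    have e3 : 0 ≤ ∑ i, ∑ j, ∑ l, (B i j l + B j i l + B l j i) := by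
      refine Finset.sum_nonneg fun i _ => Finset.sum_nonneg fun j _ =>
        Finset.sum_nonneg fun l _ => ?_
      by_cases hij : i = j
      · subst hij
        have : ∀ l, B i i l = 0 := by intro l; simp [hB, hz1]
        have h2 : B l i i = 0 := by simp [hB]
        rw [this, h2]; simp
      by_cases hil : i = l
      · subst hil
        have : B i j i = 0 := by simp [hB, hz2]
        have h2 : B j i i = 0 := by simp [hB]
        rw [this, h2]; simp
      by_cases hjl : j = l
      · subst hjl
        have : B i j j = 0 := by simp [hB]
        have h2 : B j i j = 0 := by simp [hB, hz2]
        have h3 : B j j i = 0 := by simp [hB, hz1]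
        rw [this, h2, h3]; simp
      have := htri i j l hij hjl hil
      have hli : ¬ l = i := fun h => hil h.symm
      have hlj : ¬ l = j := fun h => hjl h.symm
      simp only [hB, hij, hli, hlj, if_false]
      have q1 : G i j j l = G j i j l := hs1 _ _ _ _
      have q2 : G j l i l = G l j l i := by rw [hs1, hs2]
      simp only [hG] at q1 q2 ⊢
      linarith
    simp only [Finset.sum_add_distrib] at e3
    linarith
  have hev : ∀ i j, (∑ k, ∑ l, ((if k = i then B i j l else 0) + (if k = j then B j i l else 0)
      + (if l = i then B i j k else 0) + (if l = j then B j i k else 0)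
      + (if k = i then (if l = j then G i j i j else 0) else 0)
      + (if k = j then (if l = i then G i j i j else 0) else 0)))
      = 2 * (∑ l, B i j l) + 2 * (∑ l, B j i l) + 2 * G i j i j := by
    intro i j
    simp only [Finset.sum_add_distrib]
    have k1 : ∀ (c : Fin n) (f : Fin n → ℝ),
        ∑ k, ∑ l, (if k = c then f l else 0) = ∑ l, f l := by
      intro c f
      rw [Finset.sum_comm]; simp
    have k2 : ∀ (c : Fin n) (f : Fin n → ℝ),
        ∑ k, ∑ l, (if l = c then f k else 0) = ∑ l, f l := by
      intro c f; simp
    have k3 : ∀ (c d : Fin n) (v : ℝ),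
        ∑ k, ∑ l, (if k = c then (if l = d then v else 0) else 0) = v := by
      intro c d v
      rw [k1]; simp
    rw [k1, k1, k2, k2, k3, k3]
    ring
  rw [hexp]
  refine le_trans ?_ hsum
  simp only [hev]
  simp only [Finset.sum_add_distrib, ← Finset.mul_sum, hdiag]
  have : ∑ i, ∑ j, ∑ l, B j i l = ∑ i, ∑ j, ∑ l, B i j l := by rw [Finset.sum_comm]
  linarith

/-- Triangle inequality from pairwise overlaps. -/
theorem triangle_of_overlap [FiniteDimensional ℂ E] (F : Fin 3 → Submodule ℂ E)
    (hov : ∀ i j, i ≠ j → ∀ a ∈ F i, ∀ b ∈ F j, a ∈ (F 0 ⊓ F 1 ⊓ F 2)ᗮ → b ∈ (F 0 ⊓ F 1 ⊓ F 2)ᗮ →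
      RCLike.re (inner ℂ a b) ≤ (‖a‖ ^ 2 + ‖b‖ ^ 2) / 4) (x : E) :
    ∑ i, ‖x - (F i).starProjection x‖ ^ 2 ≤ ‖∑ i, (x - (F i).starProjection x)‖ ^ 2 := by
  set R := F 0 ⊓ F 1 ⊓ F 2 with hR
  have hRF : ∀ i, R ≤ F i := by
    intro i; fin_cases i
    · exact inf_le_left.trans inf_le_left
    · exact inf_le_left.trans inf_le_right
    · exact inf_le_right
  set x0 := R.starProjection x with hx0
  set y := x - x0 with hy
  have hyR : y ∈ Rᗮ := R.sub_starProjection_mem_orthogonal x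
  have hx0R : x0 ∈ R := R.starProjection_apply_mem x
  have hsub : ∀ i, x - (F i).starProjection x = y - (F i).starProjection y := by
    intro i
    have : (F i).starProjection x0 = x0 :=
      Submodule.starProjection_eq_self_iff.2 (hRF i hx0R)
    rw [hy, map_sub, this]; abel
  simp only [hsub]
  set v : Fin 3 → E := fun i => (F i).starProjection y with hv
  have hvF : ∀ i, v i ∈ F i := fun i => (F i).starProjection_apply_mem y
  have hvR : ∀ i, v i ∈ Rᗮ := by
    intro i
    rw [Submodule.mem_orthogonal]
    intro u hu
    simp only [hv]
    rw [← Submodule.inner_starProjection_left_eq_right,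
      Submodule.starProjection_eq_self_iff.2 (hRF i hu)]
    exact (Submodule.mem_orthogonal R y).1 hyR u hu
  have hself : ∀ i, RCLike.re (inner ℂ y (v i)) = ‖v i‖ ^ 2 := by
    intro i
    rw [← inner_self_eq_norm_sq (𝕜 := ℂ)]
    have : v i = (F i).starProjection (v i) :=
      (Submodule.starProjection_eq_self_iff.2 (hvF i)).symm
    conv_lhs => rw [this]
    rw [← Submodule.inner_starProjection_left_eq_right]
  have hnorm : ∀ i, ‖y - v i‖ ^ 2 = ‖y‖ ^ 2 - ‖v i‖ ^ 2 := by
    intro i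
    rw [@norm_sub_sq ℂ, hself]; ring
  set s := ∑ i, v i with hs
  set p := RCLike.re (inner ℂ y s) with hp
  have hps : p = ∑ i, ‖v i‖ ^ 2 := by
    rw [hp, hs, inner_sum, map_sum]
    exact Finset.sum_congr rfl fun i _ => hself i
  have hs2 : ‖s‖ ^ 2 ≤ 2 * p := by
    rw [hps, hs]
    simp only [Fin.sum_univ_three]
    rw [@norm_add_sq ℂ, @norm_add_sq ℂ, inner_add_left, map_add]
    have h01 := hov 0 1 (by decide) _ (hvF 0) _ (hvF 1) (hvR 0) (hvR 1)
    have h02 := hov 0 2 (by decide) _ (hvF 0) _ (hvF 2) (hvR 0) (hvR 2)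
    have h12 := hov 1 2 (by decide) _ (hvF 1) _ (hvF 2) (hvR 1) (hvR 2)
    linarith
  have hlhs : ∑ i, ‖y - v i‖ ^ 2 = 3 * ‖y‖ ^ 2 - p := by
    simp only [hnorm, Finset.sum_sub_distrib, hps]
    simp
  have hrhs : ‖∑ i, (y - v i)‖ ^ 2 = 9 * ‖y‖ ^ 2 - 6 * p + ‖s‖ ^ 2 := by
    rw [Finset.sum_sub_distrib]
    have : ∑ _i : Fin 3, y = (3 : ℂ) • y := by
      simp [← Nat.cast_smul_eq_nsmul ℂ]
    rw [this, ← hs, @norm_sub_sq ℂ, norm_smul, inner_smul_left]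
    have h3 : RCLike.re ((starRingEnd ℂ) 3 * inner ℂ y s) = 3 * p := by
      rw [hp]
      have : (starRingEnd ℂ) (3 : ℂ) = ((3 : ℝ) : ℂ) := by
        rw [Complex.conj_eq_iff_real.2 ⟨3, by norm_num⟩]; norm_num
      rw [this]
      exact RCLike.re_ofReal_mul 3 _
    rw [h3]; norm_num; ring
  change ∑ i, ‖y - v i‖ ^ 2 ≤ ‖∑ i, (y - v i)‖ ^ 2
  rw [hlhs, hrhs]
  have hcs : p ≤ ‖y‖ * ‖s‖ := (re_inner_le_norm y s)
  have hp0 : 0 ≤ p := by rw [hps]; positivity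
  have hp2 : p ≤ 2 * ‖y‖ ^ 2 := by
    by_contra hlt
    push Not at hlt
    have h1 : p ^ 2 ≤ ‖y‖ ^ 2 * ‖s‖ ^ 2 := by
      rw [← mul_pow]; exact pow_le_pow_left₀ hp0 hcs 2
    have h2 : ‖y‖ ^ 2 * ‖s‖ ^ 2 ≤ ‖y‖ ^ 2 * (2 * p) := by gcongr
    nlinarith [norm_nonneg y, sq_nonneg ‖y‖]
  rcases eq_or_lt_of_le (sq_nonneg ‖y‖) with h | h
  · nlinarith [sq_nonneg ‖s‖]
  · have h1 : p ^ 2 ≤ ‖y‖ ^ 2 * ‖s‖ ^ 2 := by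
      rw [← mul_pow]; exact pow_le_pow_left₀ hp0 hcs 2
    have h3 : 0 ≤ (2 * ‖y‖ ^ 2 - p) * (3 * ‖y‖ ^ 2 - p) :=
      mul_nonneg (by linarith) (by linarith)
    have h4 : 0 ≤ ‖y‖ ^ 2 * (6 * ‖y‖ ^ 2 - 5 * p + ‖s‖ ^ 2) := by nlinarith
    have h5 := nonneg_of_mul_nonneg_right h4 h
    linarith

/-- Contraction from the gap inequality `H² ≥ H`. -/
theorem contraction_of_gap [FiniteDimensional ℂ E] (H P : E →ₗ[ℂ] E) (N : ℝ) (hN : 1 ≤ N)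
    (hH : H.IsSymmetric)
    (hgap : ∀ x, RCLike.re (inner ℂ x (H x)) ≤ ‖H x‖ ^ 2)
    (hnn : ∀ x, 0 ≤ RCLike.re (inner ℂ x (H x)))
    (hub : ∀ x, RCLike.re (inner ℂ x (H x)) ≤ N * ‖x‖ ^ 2)
    (hPH : ∀ x, P (H x) = 0) (hker : ∀ x, H x = 0 → P x = x) (k : ℕ) (x : E) :
    ‖((1 - (N⁻¹ : ℂ) • H) ^ k) x - P x‖ ≤ (1 - 1 / N) ^ k * ‖x‖ := by
  set b := hH.eigenvectorBasis rfl with hb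
  set ev := hH.eigenvalues rfl with hev
  have hN0 : (0 : ℝ) < N := by linarith
  have hHb : ∀ i, H (b i) = (ev i : ℂ) • b i := fun i => hH.apply_eigenvectorBasis rfl i
  have hbn : ∀ i, ‖b i‖ = 1 := fun i => b.orthonormal.1 i
  have hip : ∀ i, RCLike.re (inner ℂ (b i) (H (b i))) = ev i := by
    intro i
    rw [hHb, inner_smul_right, inner_self_eq_norm_sq_to_K, hbn]
    simp
  have hpow : ∀ i, ((1 - (N⁻¹ : ℂ) • H) ^ k) (b i) = ((1 - N⁻¹ * ev i : ℝ) : ℂ) ^ k • b i := by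
    intro i
    induction k with
    | zero => simp
    | succ m ih =>
      rw [pow_succ', Module.End.mul_apply, ih, map_smul, pow_succ, mul_smul]
      congr 1
      rw [LinearMap.sub_apply, LinearMap.smul_apply, hHb, Module.End.one_apply, smul_smul]
      push_cast
      rw [sub_smul, one_smul]
  have hdiag : ∀ i, ∃ c : ℂ, ‖c‖ ≤ (1 - 1 / N) ^ k ∧
      ((1 - (N⁻¹ : ℂ) • H) ^ k) (b i) - P (b i) = c • b i := by
    intro i
    have hq : 0 ≤ 1 - 1 / N := by
      rw [sub_nonneg, div_le_one hN0]; exact hN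
    by_cases h0 : ev i = 0
    · refine ⟨0, by simpa using pow_nonneg hq k, ?_⟩
      have : P (b i) = b i := hker _ (by rw [hHb, h0]; simp)
      rw [hpow, this, h0]; simp
    · have hP0 : P (b i) = 0 := by
        have := hPH (b i)
        rw [hHb, map_smul, smul_eq_zero] at this
        rcases this with h | h
        · exact absurd (by exact_mod_cast h) h0
        · exact h
      have h1 := hgap (b i)
      have h2 := hnn (b i)
      have h3 := hub (b i)
      rw [hip] at h1 h2 h3
      rw [hHb, norm_smul, hbn] at h1
      rw [hbn] at h3
      simp only [Complex.norm_real, Real.norm_eq_abs, mul_one, sq_abs] at h1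
      have hpos : 0 < ev i := lt_of_le_of_ne h2 (Ne.symm h0)
      have h4 : 1 ≤ ev i := by nlinarith
      refine ⟨((1 - N⁻¹ * ev i : ℝ) : ℂ) ^ k, ?_, by rw [hpow, hP0, sub_zero]⟩
      rw [norm_pow, Complex.norm_real, Real.norm_eq_abs]
      have h5 : N⁻¹ * ev i ≤ 1 := by
        rw [inv_mul_le_iff₀ hN0]; linarith
      have h6 : N⁻¹ ≤ N⁻¹ * ev i := by
        have : 0 < N⁻¹ := inv_pos.2 hN0
        nlinarith
      rw [abs_of_nonneg (by linarith)]
      apply pow_le_pow_left₀ (by linarith)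
      rw [one_div]; linarith
  choose c hc hcb using hdiag
  have hq : 0 ≤ (1 - 1 / N) ^ k := by
    apply pow_nonneg
    rw [sub_nonneg, div_le_one hN0]; exact hN
  set T : E →ₗ[ℂ] E := (1 - (N⁻¹ : ℂ) • H) ^ k - P with hT
  have hTx : T x = ∑ i, (c i * b.repr x i) • b i := by
    conv_lhs => rw [← b.sum_repr x]
    rw [map_sum]
    refine Finset.sum_congr rfl fun i _ => ?_
    rw [map_smul, hT, LinearMap.sub_apply, hcb, smul_smul, mul_comm]
  have hnormsq : ‖T x‖ ^ 2 ≤ ((1 - 1 / N) ^ k * ‖x‖) ^ 2 := by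
    rw [hTx, ← b.repr.norm_map, ← b.repr.norm_map x, EuclideanSpace.norm_sq_eq, mul_pow,
      EuclideanSpace.norm_sq_eq, Finset.mul_sum]
    refine Finset.sum_le_sum fun i _ => ?_
    have : b.repr (∑ j, (c j * b.repr x j) • b j) i = c i * b.repr x i := by
      rw [map_sum]
      simp [b.repr_self, Pi.single_apply]
    rw [this, norm_mul, mul_pow]
    gcongr
    exact hc i
  have := abs_le_abs_of_sq_le_sq hnormsq
  rwa [abs_of_nonneg (norm_nonneg _), abs_of_nonneg (by positivity)] at this
where abs_le_abs_of_sq_le_sq {a b : ℝ} (h : a ^ 2 ≤ b ^ 2) : |a| ≤ |b| := sq_le_sq.1 h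

end Abstract

section AbstractMain

variable {E : Type*} [NormedAddCommGroup E] [InnerProductSpace ℂ E]

theorem sum_pairs_eq {M : Type*} [AddCommMonoid M] {n : ℕ} (a : Fin n → Fin n → M)
    (h0 : ∀ i, a i i = 0) (hsymm : ∀ i j, a i j = a j i) :
    ∑ i, ∑ j, a i j =
      (∑ p ∈ Finset.univ.filter (fun p : Fin n × Fin n => p.1 < p.2), a p.1 p.2)
      + ∑ p ∈ Finset.univ.filter (fun p : Fin n × Fin n => p.1 < p.2), a p.1 p.2 := by
  classical
  have h1 : ∑ i, ∑ j, a i j = ∑ p : Fin n × Fin n, a p.1 p.2 := by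
    rw [Fintype.sum_prod_type]
  have h2 : ∑ p ∈ Finset.univ.filter (fun p : Fin n × Fin n => p.1 < p.2), a p.1 p.2
      = ∑ p ∈ Finset.univ.filter (fun p : Fin n × Fin n => p.2 < p.1), a p.1 p.2 := by
    refine Finset.sum_nbij' Prod.swap Prod.swap ?_ ?_ ?_ ?_ ?_
    · intro p hp; simpa using hp
    · intro p hp; simpa using hp
    · intro p _; simp
    · intro p _; simp
    · intro p _; simpa using hsymm p.1 p.2
  rw [h1]
  conv_rhs => arg 2; rw [h2]
  rw [Finset.sum_filter, Finset.sum_filter, ← Finset.sum_add_distrib]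
  refine Finset.sum_congr rfl fun p _ => ?_
  rcases lt_trichotomy p.1 p.2 with h | h | h
  · simp [h, h.le, not_lt.2 h.le]
  · simp [h, h0]
  · simp [h, not_lt.2 h.le]

theorem card_pairs (n : ℕ) :
    (Finset.univ.filter (fun p : Fin n × Fin n => p.1 < p.2)).card = n.choose 2 := by
  have h := sum_pairs_eq (n := n) (fun i j => if i = j then (0 : ℕ) else 1)
    (by simp) (by intro i j; simp [eq_comm])
  have h1 : ∑ p ∈ Finset.univ.filter (fun p : Fin n × Fin n => p.1 < p.2),
      (if p.1 = p.2 then (0 : ℕ) else 1)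
      = (Finset.univ.filter (fun p : Fin n × Fin n => p.1 < p.2)).card := by
    rw [Finset.card_eq_sum_ones]
    refine Finset.sum_congr rfl fun p hp => ?_
    rw [if_neg (by simpa using ne_of_lt (Finset.mem_filter.1 hp).2)]
  rw [h1] at h
  have h2 : ∀ i : Fin n, ∑ j, (if i = j then (0 : ℕ) else 1) = n - 1 := by
    intro i
    rw [Finset.sum_ite]
    simp only [Finset.sum_const_zero, zero_add, Finset.sum_const, smul_eq_mul, mul_one]
    rw [Finset.filter_not, Finset.card_sdiff, Finset.filter_eq]
    simp
  simp only [h2] at h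
  simp only [Finset.sum_const, Finset.card_univ, Fintype.card_fin, smul_eq_mul] at h
  rw [Nat.choose_two_right]
  omega

theorem abstract_main [FiniteDimensional ℂ E] (n : ℕ) (hn : 3 ≤ n)
    (F : Fin n → Fin n → Submodule ℂ E) (FH : Submodule ℂ E)
    (hsymm : ∀ i j, i ≠ j → F i j = F j i)
    (hov : ∀ i j k, i ≠ j → j ≠ k → i ≠ k → ∀ a ∈ F i j, ∀ b ∈ F j k,
      a ∈ (F i j ⊓ F j k ⊓ F i k)ᗮ → b ∈ (F i j ⊓ F j k ⊓ F i k)ᗮ →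
      RCLike.re (inner ℂ a b) ≤ (‖a‖ ^ 2 + ‖b‖ ^ 2) / 4)
    (hdis : ∀ i j k l, i ≠ j → k ≠ l → i ≠ k → i ≠ l → j ≠ k → j ≠ l → ∀ x,
      (F i j).starProjection ((F k l).starProjection x)
        = (F k l).starProjection ((F i j).starProjection x))
    (hle : ∀ i j, i ≠ j → FH ≤ F i j)
    (hinf : ∀ x, (∀ i j, i ≠ j → x ∈ F i j) → x ∈ FH)
    (k : ℕ) (x : E) :
    ‖(fun y => (n.choose 2 : ℂ)⁻¹ •
        ∑ p ∈ Finset.univ.filter (fun p : Fin n × Fin n => p.1 < p.2),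
          (F p.1 p.2).starProjection y)^[k] x - FH.starProjection x‖
      ≤ (1 - 1 / (5 * (n : ℝ) ^ 2)) ^ k * ‖x‖ := by
  classical
  set S := Finset.univ.filter (fun p : Fin n × Fin n => p.1 < p.2) with hS
  set H : E →ₗ[ℂ] E := ∑ p ∈ S, (LinearMap.id - (F p.1 p.2).starProjection.toLinearMap) with hH
  have hHx : ∀ y, H y = ∑ p ∈ S, (y - (F p.1 p.2).starProjection y) := by
    intro y; simp [hH, LinearMap.sum_apply]
  have hSne : ∀ p ∈ S, p.1 ≠ p.2 := fun p hp => ne_of_lt (Finset.mem_filter.1 hp).2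
  have hNn : ((n.choose 2 : ℕ) : ℝ) = n * (n - 1) / 2 := by
    rw [Nat.cast_choose_two]
  have hn3 : (3 : ℝ) ≤ n := by exact_mod_cast hn
  have hN1 : (1 : ℝ) ≤ ((n.choose 2 : ℕ) : ℝ) := by rw [hNn]; nlinarith
  have hself : ∀ (K : Submodule ℂ E) (y : E),
      RCLike.re (inner ℂ y (y - K.starProjection y)) = ‖y - K.starProjection y‖ ^ 2 := by
    intro K y
    rw [← inner_self_eq_norm_sq (𝕜 := ℂ), inner_sub_left (y) (K.starProjection y), map_sub]
    have : inner ℂ (K.starProjection y) (y - K.starProjection y) = (0 : ℂ) :=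
      (Submodule.mem_orthogonal K _).1 (K.sub_starProjection_mem_orthogonal y) _
        (K.starProjection_apply_mem y)
    rw [this, map_zero, sub_zero]
  have hquad : ∀ y, RCLike.re (inner ℂ y (H y))
      = ∑ p ∈ S, ‖y - (F p.1 p.2).starProjection y‖ ^ 2 := by
    intro y
    rw [hHx, inner_sum, map_sum]
    exact Finset.sum_congr rfl fun p _ => hself _ y
  have hsym : H.IsSymmetric := by
    intro y z
    rw [hHx, hHx, sum_inner, inner_sum]
    refine Finset.sum_congr rfl fun p _ => ?_
    rw [inner_sub_left, inner_sub_right, Submodule.inner_starProjection_left_eq_right]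
  have hgap : ∀ y, RCLike.re (inner ℂ y (H y)) ≤ ‖H y‖ ^ 2 := by
    intro y
    set a : Fin n → Fin n → E :=
      fun i j => if i = j then 0 else y - (F i j).starProjection y with ha
    have ha0 : ∀ i, a i i = 0 := by intro i; simp [ha]
    have hane : ∀ i j, i ≠ j → a i j = y - (F i j).starProjection y := by
      intro i j hij; simp [ha, hij]
    have has : ∀ i j, a i j = a j i := by
      intro i j
      by_cases hij : i = j
      · rw [hij]
      · rw [hane i j hij, hane j i (Ne.symm hij)]
        simp only [hsymm i j hij]
    have key := knabe_sum a ha0 has ?_ ?_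
    · have e1 : ∑ i, ∑ j, a i j = (2 : ℂ) • H y := by
        rw [sum_pairs_eq a ha0 has, hHx, two_smul]
        rw [Finset.sum_congr rfl fun p hp => hane p.1 p.2 (hSne p hp)]
      have e2 : ∑ i, ∑ j, ‖a i j‖ ^ 2 = 2 * RCLike.re (inner ℂ y (H y)) := by
        rw [sum_pairs_eq (fun i j => ‖a i j‖ ^ 2) (by intro i; simp [ha0])
          (by intro i j; simp only [has i j]), hquad, two_mul]
        rw [Finset.sum_congr rfl fun p hp => by rw [hane p.1 p.2 (hSne p hp)]]
      rw [e1, e2, norm_smul, mul_pow] at key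
      norm_num at key
      simp only [RCLike.re_eq_complex_re] at key ⊢
      linarith
    · intro i j l hij hjl hil
      have ht := triangle_of_overlap ![F i j, F j l, F i l] ?_ y
      · simp only [Fin.sum_univ_three] at ht
        simp only [Matrix.cons_val_zero, Matrix.cons_val_one, Matrix.cons_val] at ht
        rw [← hane i j hij, ← hane j l hjl, ← hane i l hil] at ht
        rw [@norm_add_sq ℂ _ _ _ _ (a i j + a j l), @norm_add_sq ℂ _ _ _ _ (a i j),
          inner_add_left, map_add] at ht
        linarith
      · have g01 := hov i j l hij hjl hil
        have g10 := hov l j i (Ne.symm hjl) (Ne.symm hij) (Ne.symm hil)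
        have g02 := hov j i l (Ne.symm hij) hil hjl
        have g20 := hov l i j (Ne.symm hil) hij (Ne.symm hjl)
        have g12 := hov j l i hjl (Ne.symm hil) (Ne.symm hij)
        have g21 := hov i l j hil (Ne.symm hjl) hij
        simp only [hsymm j i (Ne.symm hij), hsymm l j (Ne.symm hjl),
          hsymm l i (Ne.symm hil)] at g01 g10 g02 g20 g12 g21
        have q1 : F j l ⊓ F i j ⊓ F i l = F i j ⊓ F j l ⊓ F i l := by
          rw [inf_comm (F j l)]
        have q2 : F i j ⊓ F i l ⊓ F j l = F i j ⊓ F j l ⊓ F i l := by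
          rw [inf_right_comm]
        have q3 : F i l ⊓ F i j ⊓ F j l = F i j ⊓ F j l ⊓ F i l := by
          rw [inf_comm (F i l), inf_right_comm]
        have q4 : F j l ⊓ F i l ⊓ F i j = F i j ⊓ F j l ⊓ F i l := by
          rw [inf_right_comm, inf_comm (F j l)]
        have q5 : F i l ⊓ F j l ⊓ F i j = F i j ⊓ F j l ⊓ F i l := by
          rw [inf_comm, ← inf_assoc, inf_right_comm]
        rw [q1] at g10
        rw [q2] at g02
        rw [q3] at g20
        rw [q4] at g12
        rw [q5] at g21
        intro i' j' hne
        fin_cases i' <;> fin_cases j' <;> first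
          | exact absurd rfl hne
          | exact g01
          | exact g10
          | exact g02
          | exact g20
          | exact g12
          | exact g21
    · intro i j l m hij hlm hil him hjl hjm
      rw [hane i j hij, hane l m hlm]
      set P := (F i j).starProjection with hP
      set Q := (F l m).starProjection with hQ
      have hc : ∀ z, P (Q z) = Q (P z) := hdis i j l m hij hlm hil him hjl hjm
      have hPP : ∀ z, P (P z) = P z := fun z =>
        Submodule.starProjection_eq_self_iff.2 ((F i j).starProjection_apply_mem z)
      have hQQ : ∀ z, Q (Q z) = Q z := fun z =>
        Submodule.starProjection_eq_self_iff.2 ((F l m).starProjection_apply_mem z)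
      have hPs : ∀ u v, inner ℂ (P u) v = inner ℂ u (P v) :=
        fun u v => Submodule.inner_starProjection_left_eq_right _ u v
      have hQs : ∀ u v, inner ℂ (Q u) v = inner ℂ u (Q v) :=
        fun u v => Submodule.inner_starProjection_left_eq_right _ u v
      have : inner ℂ (y - P y) (y - Q y)
          = inner ℂ (y - P y - Q (y - P y)) (y - P y - Q (y - P y)) := by
        simp only [inner_sub_left, inner_sub_right, map_sub, hPs, hQs, hc, hQQ, hPP]
        have r1 : ∀ z, P (Q (P z)) = Q (P z) := by intro z; rw [hc, hPP]
        simp only [← hc, hPP, hQQ]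
        ring
      rw [this]
      exact inner_self_nonneg
  have hG : ∀ y, (1 - ((((n.choose 2 : ℕ) : ℝ))⁻¹ : ℂ) • H) y
      = (n.choose 2 : ℂ)⁻¹ • ∑ p ∈ S, (F p.1 p.2).starProjection y := by
    intro y
    rw [LinearMap.sub_apply, LinearMap.smul_apply, hHx, Finset.sum_sub_distrib,
      Finset.sum_const, hS, card_pairs, smul_sub, ← Nat.cast_smul_eq_nsmul ℂ, smul_smul]
    have : ((n.choose 2 : ℕ) : ℂ) ≠ 0 := by
      have : ((n.choose 2 : ℕ) : ℝ) ≠ 0 := by linarith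
      exact_mod_cast this
    push_cast
    rw [inv_mul_cancel₀ this]
    simp
  have hiter : (fun y => (n.choose 2 : ℂ)⁻¹ • ∑ p ∈ S, (F p.1 p.2).starProjection y)^[k] x
      = ((1 - ((((n.choose 2 : ℕ) : ℝ))⁻¹ : ℂ) • H) ^ k) x := by
    rw [Module.End.pow_apply]
    congr 1
    congr 1
    funext y
    exact (hG y).symm
  rw [hiter]
  have hmain := contraction_of_gap H FH.starProjection.toLinearMap ((n.choose 2 : ℕ) : ℝ) hN1
    hsym hgap ?_ ?_ ?_ ?_ k x
  · refine hmain.trans ?_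
    have h1 : 0 ≤ 1 - 1 / ((n.choose 2 : ℕ) : ℝ) := by
      rw [sub_nonneg, div_le_one (by linarith)]; exact hN1
    gcongr
    rw [hNn]
    nlinarith
  · intro y
    rw [hquad]
    positivity
  · intro y
    rw [hquad, ← card_pairs, ← hS, ← nsmul_eq_mul]
    refine Finset.sum_le_card_nsmul _ _ _ fun p _ => ?_
    have := Submodule.norm_sq_eq_add_norm_sq_starProjection y (F p.1 p.2)
    rw [Submodule.starProjection_orthogonal_val] at this
    nlinarith [sq_nonneg ‖(F p.1 p.2).starProjection y‖]
  · intro y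
    change FH.starProjection (H y) = 0
    rw [hHx, map_sum]
    refine Finset.sum_eq_zero fun p hp => ?_
    rw [Submodule.starProjection_apply_eq_zero_iff]
    exact Submodule.orthogonal_le (hle p.1 p.2 (hSne p hp))
      ((F p.1 p.2).sub_starProjection_mem_orthogonal y)
  · intro y hy
    change FH.starProjection y = y
    rw [Submodule.starProjection_eq_self_iff]
    have h0 := hquad y
    rw [hy, inner_zero_right, map_zero] at h0
    have h1 := (Finset.sum_eq_zero_iff_of_nonneg (fun p _ => by positivity)).1 h0.symm
    have h2 : ∀ p ∈ S, y ∈ F p.1 p.2 := by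
      intro p hp
      have := h1 p hp
      rw [sq_eq_zero_iff, norm_eq_zero, sub_eq_zero] at this
      exact Submodule.starProjection_eq_self_iff.1 this.symm
    apply hinf
    intro i j hij
    rcases lt_or_gt_of_ne hij with h | h
    · exact h2 (i, j) (Finset.mem_filter.2 ⟨Finset.mem_univ _, h⟩)
    · rw [hsymm i j hij]
      exact h2 (j, i) (Finset.mem_filter.2 ⟨Finset.mem_univ _, h⟩)

end AbstractMain

section Average

/-- Matrices as a Euclidean space (Hilbert-Schmidt inner product). -/
noncomputable def matE (ι : Type*) [Fintype ι] :
    Matrix ι ι ℂ ≃ₗ[ℂ] EuclideanSpace ℂ (ι × ι) where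
  toFun X := WithLp.toLp 2 (fun p => X p.1 p.2)
  invFun v := fun x y => v (x, y)
  map_add' X Y := by ext p; rfl
  map_smul' c X := by ext p; rfl
  left_inv X := rfl
  right_inv v := rfl

variable {ι : Type*} [Fintype ι] [DecidableEq ι]

theorem matE_apply (X : Matrix ι ι ℂ) (p : ι × ι) : matE ι X p = X p.1 p.2 := rfl

theorem frobNorm_eq (X : Matrix ι ι ℂ) : frobNorm X = ‖matE ι X‖ := by
  rw [EuclideanSpace.norm_eq, frobNorm, Fintype.sum_prod_type]
  rfl

theorem inner_matE (X Y : Matrix ι ι ℂ) :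
    inner ℂ (matE ι X) (matE ι Y) = ∑ x, ∑ y, star (X x y) * Y x y := by
  rw [PiLp.inner_apply, Fintype.sum_prod_type]
  refine Finset.sum_congr rfl fun x _ => Finset.sum_congr rfl fun y _ => ?_
  simp [matE_apply, mul_comm]

theorem inner_matE_trace (X Y : Matrix ι ι ℂ) :
    inner ℂ (matE ι X) (matE ι Y) = Matrix.trace (Xᴴ * Y) := by
  rw [inner_matE, Matrix.trace, Finset.sum_comm]
  refine Finset.sum_congr rfl fun x _ => ?_
  rw [Matrix.diag_apply, Matrix.mul_apply]
  refine Finset.sum_congr rfl fun y _ => ?_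
  rw [Matrix.conjTranspose_apply]

/-- The commutant of a set of matrices, as a subspace of the Hilbert-Schmidt space. -/
noncomputable def commE (S : Set (Matrix ι ι ℂ)) : Submodule ℂ (EuclideanSpace ℂ (ι × ι)) where
  carrier := {v | ∀ A ∈ S, A * (matE ι).symm v = (matE ι).symm v * A}
  add_mem' := by
    intro a b ha hb A hA
    rw [map_add, mul_add, add_mul, ha A hA, hb A hA]
  zero_mem' := by intro A _; simp
  smul_mem' := by
    intro c a ha A hA
    rw [map_smul, Matrix.mul_smul, Matrix.smul_mul, ha A hA]

theorem mem_commE {S : Set (Matrix ι ι ℂ)} {X : Matrix ι ι ℂ} :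
    matE ι X ∈ commE S ↔ ∀ A ∈ S, A * X = X * A := by
  change (∀ A ∈ S, A * (matE ι).symm (matE ι X) = (matE ι).symm (matE ι X) * A) ↔ _
  rw [LinearEquiv.symm_apply_apply]

theorem conj_entry (A X : Matrix ι ι ℂ) (x y : ι) :
    (A * X * Aᴴ) x y = ∑ a, ∑ b, A x a * X a b * star (A y b) := by
  rw [Matrix.mul_apply, Finset.sum_comm]
  refine Finset.sum_congr rfl fun b _ => ?_
  rw [Matrix.mul_apply, Finset.sum_mul, Matrix.conjTranspose_apply]

theorem commute_of_conj {A X : Matrix ι ι ℂ} (hA : A ∈ Matrix.unitaryGroup ι ℂ)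
    (h : A * X * Aᴴ = X) : A * X = X * A := by
  have hA' : Aᴴ * A = 1 := (Matrix.mem_unitaryGroup_iff'.1 hA)
  calc A * X = A * X * (Aᴴ * A) := by rw [hA', mul_one]
    _ = (A * X * Aᴴ) * A := by simp only [mul_assoc]
    _ = X * A := by rw [h]

theorem average_eq_proj {G : Type*} [Group G] [TopologicalSpace G] [MeasurableSpace G]
    [BorelSpace G] [ContinuousMul G] (μ : Measure G) [μ.IsMulLeftInvariant]
    [IsProbabilityMeasure μ] (A : G → Matrix ι ι ℂ) (hmul : ∀ g h, A (g * h) = A g * A h)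
    (hu : ∀ g, A g ∈ Matrix.unitaryGroup ι ℂ) (hcont : Continuous A) (X : Matrix ι ι ℂ) :
    matE ι (fun x y => ∫ g, (A g * X * (A g)ᴴ) x y ∂μ)
      = (commE (Set.range A)).starProjection (matE ι X) := by
  set Y : Matrix ι ι ℂ := fun x y => ∫ g, (A g * X * (A g)ᴴ) x y ∂μ with hY
  have hInt : ∀ x y, Integrable (fun g => (A g * X * (A g)ᴴ) x y) μ := by
    intro x y
    refine Integrable.of_bound (C := ∑ a, ∑ b, ‖X a b‖) ?_ ?_
    · have hc : Continuous (fun g => (A g * X * (A g)ᴴ) x y) := by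
        have : Continuous (fun g => (A g * X * (A g)ᴴ)) := by fun_prop
        exact this.matrix_elem x y
      exact hc.aestronglyMeasurable
    · refine Filter.Eventually.of_forall fun g => ?_
      rw [conj_entry]
      refine (norm_sum_le _ _).trans (Finset.sum_le_sum fun a _ => ?_)
      refine (norm_sum_le _ _).trans (Finset.sum_le_sum fun b _ => ?_)
      rw [norm_mul, norm_mul, norm_star]
      have h1 := entry_norm_bound_of_unitary (hu g) x a
      have h2 := entry_norm_bound_of_unitary (hu g) y b
      calc ‖A g x a‖ * ‖X a b‖ * ‖A g y b‖ ≤ 1 * ‖X a b‖ * 1 := by gcongr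
        _ = ‖X a b‖ := by ring
  symm
  apply Submodule.eq_starProjection_of_mem_of_inner_eq_zero
  · rw [mem_commE]
    rintro _ ⟨h, rfl⟩
    apply commute_of_conj (hu h)
    ext x y
    rw [conj_entry]
    have e1 : ∀ a b, A h x a * Y a b * star (A h y b)
        = ∫ g, A h x a * (A g * X * (A g)ᴴ) a b * star (A h y b) ∂μ := by
      intro a b
      rw [hY, ← integral_const_mul, ← integral_mul_const]
    simp only [e1]
    have hI : ∀ a b, Integrable
        (fun g => A h x a * (A g * X * (A g)ᴴ) a b * star (A h y b)) μ :=
      fun a b => ((hInt a b).const_mul _).mul_const _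
    rw [Finset.sum_congr rfl fun a _ => (integral_finsetSum _ fun b _ => hI a b).symm]
    rw [← integral_finsetSum _ fun a _ => integrable_finsetSum _ fun b _ => hI a b]
    rw [hY]
    simp only [← conj_entry]
    rw [← integral_mul_left_eq_self (fun g => (A g * X * (A g)ᴴ) x y) h]
    congr 1
    funext g
    rw [hmul, Matrix.conjTranspose_mul]
    simp only [mul_assoc]
  · intro w hw
    obtain ⟨W, rfl⟩ := (matE ι).surjective w
    rw [mem_commE] at hw
    rw [inner_sub_left, sub_eq_zero, inner_matE Y]
    have e1 : ∀ x y, star (Y x y) * W x y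
        = ∫ g, star ((A g * X * (A g)ᴴ) x y) * W x y ∂μ := by
      intro x y
      rw [integral_mul_const]
      congr 1
      simp only [hY]
      exact (integral_conj (f := fun g => (A g * X * (A g)ᴴ) x y)).symm
    have hI : ∀ x y, Integrable (fun g => star ((A g * X * (A g)ᴴ) x y) * W x y) μ := by
      intro x y
      refine Integrable.mul_const ?_ _
      exact (Complex.conjCLE.integrable_comp_iff (φ := fun g => (A g * X * (A g)ᴴ) x y)).2 (hInt x y)
    simp only [e1]
    rw [Finset.sum_congr rfl fun a _ => (integral_finsetSum _ fun b _ => hI a b).symm]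
    rw [← integral_finsetSum _ fun a _ => integrable_finsetSum _ fun b _ => hI a b]
    simp only [← inner_matE]
    have : ∀ g, inner ℂ (matE ι (A g * X * (A g)ᴴ)) (matE ι W) = inner ℂ (matE ι X) (matE ι W) := by
      intro g
      have hA' : (A g)ᴴ * A g = 1 := (Matrix.mem_unitaryGroup_iff'.1 (hu g))
      rw [inner_matE_trace, inner_matE_trace, Matrix.conjTranspose_mul, Matrix.conjTranspose_mul,
        Matrix.conjTranspose_conjTranspose, mul_assoc, Matrix.trace_mul_comm, mul_assoc, mul_assoc,
        ← hw (A g) ⟨g, rfl⟩, ← mul_assoc (A g)ᴴ, hA', one_mul]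
    simp only [this]
    simp

/-- Commuting unitary families have commuting commutant projections. -/
theorem proj_comm (S T : Set (Matrix ι ι ℂ)) (hS : ∀ A ∈ S, Aᴴ ∈ S)
    (hcomm : ∀ A ∈ S, ∀ B ∈ T, A * B = B * A) (hT : ∀ B ∈ T, Bᴴ ∈ T)
    (x : EuclideanSpace ℂ (ι × ι)) :
    (commE S).starProjection ((commE T).starProjection x)
      = (commE T).starProjection ((commE S).starProjection x) := by
  set P := (commE S).starProjection with hP
  set Q := (commE T).starProjection with hQ
  -- Q preserves the commutant of S
  have key : ∀ y ∈ commE S, Q y ∈ commE S := by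
    intro y hy
    obtain ⟨Y, rfl⟩ := (matE ι).surjective y
    obtain ⟨Z, hZ⟩ := (matE ι).surjective (Q (matE ι Y))
    rw [← hZ, mem_commE]
    rw [mem_commE] at hy
    have hZT : matE ι Z ∈ commE T := by rw [hZ]; exact (commE T).starProjection_apply_mem _
    rw [mem_commE] at hZT
    have hperp : ∀ W, (∀ B ∈ T, B * W = W * B) →
        inner ℂ (matE ι (Y - Z)) (matE ι W) = 0 := by
      intro W hW
      rw [map_sub, hZ]
      exact Submodule.starProjection_inner_eq_zero _ _ (mem_commE.2 hW)
    intro A hA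
    -- D = A Z - Z A is in the commutant of T and orthogonal to itself
    set D := A * Z - Z * A with hD
    have hDT : ∀ B ∈ T, B * D = D * B := by
      intro B hB
      have h1 := hcomm A hA B hB
      have h2 := hZT B hB
      rw [hD, mul_sub, sub_mul, ← mul_assoc, ← h1, mul_assoc, h2, ← mul_assoc, ← mul_assoc, h2,
        mul_assoc Z B A, ← h1, ← mul_assoc]
    have hcA : ∀ B ∈ T, Aᴴ * B = B * Aᴴ := fun B hB => hcomm _ (hS A hA) B hB
    have hDD : D = -(A * (Y - Z) - (Y - Z) * A) := by
      rw [hD, mul_sub, sub_mul, hy A hA]; abel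
    have i1 : inner ℂ (matE ι (A * (Y - Z))) (matE ι D) = 0 := by
      rw [← hperp (Aᴴ * D) ?_]
      · rw [inner_matE_trace, inner_matE_trace, Matrix.conjTranspose_mul, mul_assoc]
      · intro B hB
        rw [← mul_assoc, ← hcA B hB, mul_assoc, hDT B hB, mul_assoc]
    have i2 : inner ℂ (matE ι ((Y - Z) * A)) (matE ι D) = 0 := by
      rw [← hperp (D * Aᴴ) ?_]
      · rw [inner_matE_trace, inner_matE_trace, Matrix.conjTranspose_mul, mul_assoc,
          Matrix.trace_mul_comm, mul_assoc]
      · intro B hB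
        rw [← mul_assoc, hDT B hB, mul_assoc, ← hcA B hB, mul_assoc]
    have : inner ℂ (matE ι D) (matE ι D) = (0 : ℂ) := by
      conv_lhs => arg 2; rw [hDD]
      rw [map_neg, map_sub, inner_neg_left, inner_sub_left, i1, i2]; simp
    rw [inner_self_eq_zero] at this
    have hD0 : D = 0 := by simpa using this
    rwa [hD, sub_eq_zero] at hD0
  have h1 : ∀ y, P (Q (P y)) = Q (P y) := fun y =>
    Submodule.starProjection_eq_self_iff.2 (key _ ((commE S).starProjection_apply_mem y))
  have h2 : ∀ y, P (Q (P y)) = P (Q y) := by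
    intro y
    apply ext_inner_left ℂ
    intro z
    rw [hP, hQ, ← Submodule.inner_starProjection_left_eq_right,
      ← Submodule.inner_starProjection_left_eq_right, ← Submodule.inner_starProjection_left_eq_right,
      ← hP, ← hQ, h1, hP, hQ, Submodule.inner_starProjection_left_eq_right,
      Submodule.inner_starProjection_left_eq_right]
  rw [← h2, h1]

end Average

section Gates

theorem tensorPow_mul {α : Type*} [Fintype α] [DecidableEq α] (t : ℕ) (A B : Matrix α α ℂ) :
    tensorPow t (A * B) = tensorPow t A * tensorPow t B := by
  ext x y
  simp only [tensorPow, Matrix.mul_apply]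
  rw [Finset.prod_univ_sum, Fintype.piFinset_univ]
  exact Finset.sum_congr rfl fun w _ => Finset.prod_mul_distrib

theorem tensorPow_one {α : Type*} [Fintype α] [DecidableEq α] (t : ℕ) :
    tensorPow t (1 : Matrix α α ℂ) = 1 := by
  ext x y
  simp only [tensorPow, Matrix.one_apply]
  rw [Finset.prod_ite_zero]
  simp [funext_iff]

theorem tensorPow_conjTranspose {α : Type*} [Fintype α] (t : ℕ) (A : Matrix α α ℂ) :
    tensorPow t (Aᴴ) = (tensorPow t A)ᴴ := by
  ext x y
  simp [tensorPow, Matrix.conjTranspose_apply]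

theorem tensorPow_transpose {α : Type*} [Fintype α] (t : ℕ) (A : Matrix α α ℂ) (x y) :
    tensorPow t (Aᵀ) x y = (tensorPow t A) y x := by
  simp [tensorPow]

theorem tensorPow_unitary {α : Type*} [Fintype α] [DecidableEq α] (t : ℕ) {A : Matrix α α ℂ}
    (hA : A ∈ Matrix.unitaryGroup α ℂ) :
    tensorPow t A ∈ Matrix.unitaryGroup (Fin t → α) ℂ := by
  rw [Matrix.mem_unitaryGroup_iff] at hA ⊢
  rw [Matrix.star_eq_conjTranspose] at hA ⊢
  rw [← tensorPow_conjTranspose, ← tensorPow_mul, hA, tensorPow_one]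

theorem tensorPow_continuous {α : Type*} [Fintype α] (t : ℕ) :
    Continuous (tensorPow t : Matrix α α ℂ → _) := by
  refine continuous_matrix fun x y => ?_
  exact continuous_finsetProd _ fun a _ => continuous_id.matrix_elem _ _

/-- permutation invariance -/
theorem tensorPow_perm {α : Type*} [Fintype α] (t : ℕ) (A : Matrix α α ℂ)
    (π : Equiv.Perm (Fin t)) (x y : Fin t → α) :
    tensorPow t A (x ∘ π) (y ∘ π) = tensorPow t A x y := by
  simp only [tensorPow, Function.comp]
  exact Equiv.prod_comp π (fun a => A (x a) (y a))

variable {n : ℕ}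

/-- restrict to the qubits `i`, `j` -/
def rst (i j : Fin n) (x : Fin n → Fin 2) : Fin 2 × Fin 2 := (x i, x j)

/-- overwrite the qubits `i`, `j` -/
def mrg (i j : Fin n) (x : Fin n → Fin 2) (q : Fin 2 × Fin 2) : Fin n → Fin 2 :=
  fun k => if k = i then q.1 else if k = j then q.2 else x k

/-- `x` and `y` agree off `i`, `j` -/
def agr (i j : Fin n) (x y : Fin n → Fin 2) : Prop := ∀ k, k ≠ i ∧ k ≠ j → x k = y k

instance (i j : Fin n) (x y : Fin n → Fin 2) : Decidable (agr i j x y) := by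
  unfold agr; infer_instance

theorem rst_mrg {i j : Fin n} (h : i ≠ j) (x : Fin n → Fin 2) (q) : rst i j (mrg i j x q) = q := by
  simp [rst, mrg, h.symm]

theorem mrg_rst (i j : Fin n) (x : Fin n → Fin 2) : mrg i j x (rst i j x) = x := by
  funext k
  simp only [rst, mrg]
  split_ifs with h1 h2
  · rw [h1]
  · rw [h2]
  · rfl

theorem mrg_mrg (i j : Fin n) (x : Fin n → Fin 2) (q q') :
    mrg i j (mrg i j x q) q' = mrg i j x q' := by
  funext k
  simp only [mrg]
  split_ifs <;> rfl

theorem agr_mrg (i j : Fin n) (x : Fin n → Fin 2) (q) : agr i j (mrg i j x q) x := by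
  intro k hk
  simp [mrg, hk.1, hk.2]

theorem agr_symm {i j : Fin n} {x y : Fin n → Fin 2} (h : agr i j x y) : agr i j y x :=
  fun k hk => (h k hk).symm

theorem agr_trans {i j : Fin n} {x y z : Fin n → Fin 2} (h : agr i j x y) (h' : agr i j y z) :
    agr i j x z := fun k hk => (h k hk).trans (h' k hk)

theorem mrg_eq_of_agr {i j : Fin n} {x y : Fin n → Fin 2} (h : agr i j x y) :
    mrg i j x (rst i j y) = y := by
  funext k
  simp only [rst, mrg]
  split_ifs with h1 h2
  · rw [h1]
  · rw [h2]
  · exact h k ⟨h1, h2⟩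

theorem pairGate_apply (i j : Fin n) (U : Matrix (Fin 2 × Fin 2) (Fin 2 × Fin 2) ℂ)
    (x y : Fin n → Fin 2) :
    pairGate n i j U x y = U (rst i j x) (rst i j y) * if agr i j x y then 1 else 0 := by
  unfold pairGate rst
  rw [Finset.prod_ite_zero]
  simp [agr]

theorem pairGate_sum {i j : Fin n} (h : i ≠ j) (U : Matrix (Fin 2 × Fin 2) (Fin 2 × Fin 2) ℂ)
    (x : Fin n → Fin 2) (g : (Fin n → Fin 2) → ℂ) :
    ∑ y, pairGate n i j U x y * g y = ∑ q, U (rst i j x) q * g (mrg i j x q) := by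
  symm
  apply Fintype.sum_of_injective (fun q => mrg i j x q)
  · intro q q' hq
    have := congrArg (rst i j) hq
    simpa [rst_mrg h] using this
  · intro y hy
    rw [pairGate_apply, if_neg, mul_zero, zero_mul]
    intro hag
    exact hy ⟨rst i j y, mrg_eq_of_agr hag⟩
  · intro q
    rw [pairGate_apply, if_pos (agr_symm (agr_mrg _ _ _ _)), rst_mrg h, mul_one]

theorem pairGate_mul {i j : Fin n} (h : i ≠ j) (U V : Matrix (Fin 2 × Fin 2) (Fin 2 × Fin 2) ℂ) :
    pairGate n i j (U * V) = pairGate n i j U * pairGate n i j V := by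
  ext x y
  rw [Matrix.mul_apply, pairGate_sum h, pairGate_apply, Matrix.mul_apply, Finset.sum_mul]
  refine Finset.sum_congr rfl fun q _ => ?_
  rw [pairGate_apply, rst_mrg h, mul_assoc]
  congr 3
  exact propext ⟨fun h => agr_trans (agr_mrg _ _ _ _) h,
    fun h => agr_trans (agr_symm (agr_mrg _ _ _ _)) h⟩

theorem pairGate_one (i j : Fin n) : pairGate n i j 1 = 1 := by
  ext x y
  rw [pairGate_apply, Matrix.one_apply, Matrix.one_apply]
  by_cases hxy : x = y
  · subst hxy
    simp [agr]
  · rw [if_neg hxy]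
    by_cases h1 : rst i j x = rst i j y
    · rw [if_neg (c := agr i j x y), mul_zero]
      intro h2
      apply hxy
      rw [← mrg_eq_of_agr h2, ← h1, mrg_rst]
    · rw [if_neg h1, zero_mul]

theorem pairGate_conjTranspose (i j : Fin n) (U : Matrix (Fin 2 × Fin 2) (Fin 2 × Fin 2) ℂ) :
    pairGate n i j (Uᴴ) = (pairGate n i j U)ᴴ := by
  ext x y
  rw [Matrix.conjTranspose_apply, pairGate_apply, pairGate_apply, Matrix.conjTranspose_apply,
    star_mul']
  congr 1
  have : agr i j x y ↔ agr i j y x := ⟨agr_symm, agr_symm⟩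
  simp only [this]
  split_ifs <;> simp

theorem pairGate_transpose (i j : Fin n) (U : Matrix (Fin 2 × Fin 2) (Fin 2 × Fin 2) ℂ) :
    pairGate n i j (Uᵀ) = (pairGate n i j U)ᵀ := by
  ext x y
  rw [Matrix.transpose_apply, pairGate_apply, pairGate_apply, Matrix.transpose_apply]
  congr 1
  have : agr i j x y ↔ agr i j y x := ⟨agr_symm, agr_symm⟩
  simp only [this]

theorem pairGate_unitary {i j : Fin n} (h : i ≠ j) {U : Matrix (Fin 2 × Fin 2) (Fin 2 × Fin 2) ℂ}
    (hU : U ∈ Matrix.unitaryGroup (Fin 2 × Fin 2) ℂ) :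
    pairGate n i j U ∈ Matrix.unitaryGroup (Fin n → Fin 2) ℂ := by
  rw [Matrix.mem_unitaryGroup_iff] at hU ⊢
  rw [Matrix.star_eq_conjTranspose] at hU ⊢
  rw [← pairGate_conjTranspose, ← pairGate_mul h, hU, pairGate_one]

theorem pairGate_continuous (i j : Fin n) : Continuous (pairGate n i j) := by
  refine continuous_matrix fun x y => ?_
  simp only [pairGate]
  exact (continuous_id.matrix_elem _ _).mul continuous_const

theorem pairGate_mul_apply {i j k l : Fin n} (hij : i ≠ j)
    (hik : i ≠ k) (hil : i ≠ l) (hjk : j ≠ k) (hjl : j ≠ l)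
    (U V : Matrix (Fin 2 × Fin 2) (Fin 2 × Fin 2) ℂ) (x y : Fin n → Fin 2) :
    (pairGate n i j U * pairGate n k l V) x y
      = U (rst i j x) (rst i j y) * V (rst k l x) (rst k l y)
        * if (∀ m, m ≠ i ∧ m ≠ j ∧ m ≠ k ∧ m ≠ l → x m = y m) then 1 else 0 := by
  rw [Matrix.mul_apply, pairGate_sum hij, Finset.sum_eq_single (rst i j y)]
  · rw [pairGate_apply, ← mul_assoc]
    congr 2
    · simp [rst, mrg, hik.symm, hil.symm, hjk.symm, hjl.symm]
    · apply congrArg (fun p : Prop => p)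
      apply propext
      constructor
      · intro h m hm
        have := h m ⟨hm.2.2.1, hm.2.2.2⟩
        simpa [mrg, hm.1, hm.2.1] using this
      · intro h m hm
        by_cases h1 : m = i
        · simp [mrg, rst, h1]
        by_cases h2 : m = j
        · simp [mrg, rst, h2, hij.symm]
        have := h m ⟨h1, h2, hm.1, hm.2⟩
        simpa [mrg, h1, h2] using this
  · intro q _ hq
    rw [pairGate_apply, if_neg, mul_zero, mul_zero]
    intro h
    apply hq
    have h1 := h i ⟨hik, hil⟩
    have h2 := h j ⟨hjk, hjl⟩
    simp [mrg, hij.symm] at h1 h2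
    ext <;> simp [rst, h1, h2]
  · simp

theorem pairGate_comm {i j k l : Fin n} (hij : i ≠ j) (hkl : k ≠ l)
    (hik : i ≠ k) (hil : i ≠ l) (hjk : j ≠ k) (hjl : j ≠ l)
    (U V : Matrix (Fin 2 × Fin 2) (Fin 2 × Fin 2) ℂ) :
    pairGate n i j U * pairGate n k l V = pairGate n k l V * pairGate n i j U := by
  ext x y
  rw [pairGate_mul_apply hij hik hil hjk hjl,
    pairGate_mul_apply hkl hik.symm hjk.symm hil.symm hjl.symm]
  rw [mul_comm (U _ _)]
  congr 2
  apply propext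
  constructor
  · intro h m hm
    exact h m ⟨hm.2.2.1, hm.2.2.2, hm.1, hm.2.1⟩
  · intro h m hm
    exact h m ⟨hm.2.2.1, hm.2.2.2, hm.1, hm.2.1⟩

/-- restriction of a triple -/
def rst3 (i j : Fin n) (x : Fin 3 → Fin n → Fin 2) : Fin 3 → Fin 2 × Fin 2 :=
  fun a => rst i j (x a)

/-- overwrite two qubits in a triple -/
def mrg3 (i j : Fin n) (x : Fin 3 → Fin n → Fin 2) (r : Fin 3 → Fin 2 × Fin 2) :
    Fin 3 → Fin n → Fin 2 := fun a => mrg i j (x a) (r a)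

theorem rst3_mrg3 {i j : Fin n} (h : i ≠ j) (x : Fin 3 → Fin n → Fin 2) (r) :
    rst3 i j (mrg3 i j x r) = r := funext fun a => rst_mrg h _ _

theorem mrg3_rst3 (i j : Fin n) (x : Fin 3 → Fin n → Fin 2) : mrg3 i j x (rst3 i j x) = x :=
  funext fun a => mrg_rst _ _ _

theorem mrg3_mrg3 (i j : Fin n) (x : Fin 3 → Fin n → Fin 2) (r r') :
    mrg3 i j (mrg3 i j x r) r' = mrg3 i j x r' := funext fun a => mrg_mrg _ _ _ _ _

theorem tp_apply (i j : Fin n) (U : Matrix (Fin 2 × Fin 2) (Fin 2 × Fin 2) ℂ)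
    (x y : Fin 3 → Fin n → Fin 2) :
    tensorPow 3 (pairGate n i j U) x y = tensorPow 3 U (rst3 i j x) (rst3 i j y) *
      if ∀ a, agr i j (x a) (y a) then 1 else 0 := by
  simp only [tensorPow, pairGate_apply, Finset.prod_mul_distrib]
  rw [Finset.prod_ite_zero]
  simp [rst3]

theorem tp_sum_left {i j : Fin n} (h : i ≠ j) (U : Matrix (Fin 2 × Fin 2) (Fin 2 × Fin 2) ℂ)
    (x : Fin 3 → Fin n → Fin 2) (g : (Fin 3 → Fin n → Fin 2) → ℂ) :
    ∑ y, tensorPow 3 (pairGate n i j U) x y * g y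
      = ∑ r, tensorPow 3 U (rst3 i j x) r * g (mrg3 i j x r) := by
  symm
  apply Fintype.sum_of_injective (fun q => mrg3 i j x q)
  · intro q q' hq
    have := congrArg (rst3 i j) hq
    simpa [rst3_mrg3 h] using this
  · intro y hy
    rw [tp_apply, if_neg, mul_zero, zero_mul]
    intro hag
    exact hy ⟨rst3 i j y, funext fun a => mrg_eq_of_agr (hag a)⟩
  · intro q
    have hag : ∀ a, agr i j (x a) (mrg3 i j x q a) := fun a => agr_symm (agr_mrg _ _ _ _)
    rw [tp_apply, if_pos hag, rst3_mrg3 h, mul_one]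

theorem tp_sum_right {i j : Fin n} (h : i ≠ j) (U : Matrix (Fin 2 × Fin 2) (Fin 2 × Fin 2) ℂ)
    (y : Fin 3 → Fin n → Fin 2) (g : (Fin 3 → Fin n → Fin 2) → ℂ) :
    ∑ x, g x * tensorPow 3 (pairGate n i j U) x y
      = ∑ r, g (mrg3 i j y r) * tensorPow 3 U r (rst3 i j y) := by
  have := tp_sum_left h Uᵀ y g
  simp only [pairGate_transpose, tensorPow_transpose] at this
  simpa only [mul_comm] using this

theorem comm_iff {i j : Fin n} (h : i ≠ j) (U : Matrix (Fin 2 × Fin 2) (Fin 2 × Fin 2) ℂ)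
    (X : Matrix (Fin 3 → Fin n → Fin 2) (Fin 3 → Fin n → Fin 2) ℂ) :
    tensorPow 3 (pairGate n i j U) * X = X * tensorPow 3 (pairGate n i j U) ↔
    ∀ x y, ∑ r, tensorPow 3 U (rst3 i j x) r * X (mrg3 i j x r) y
      = ∑ r, X x (mrg3 i j y r) * tensorPow 3 U r (rst3 i j y) := by
  rw [← Matrix.ext_iff]
  simp only [Matrix.mul_apply, tp_sum_left h, tp_sum_right h]

end Gates

section SchurWeyl

variable {Q : Type*} [Fintype Q] [DecidableEq Q]

/-- `X` intertwines the substitution `f`. -/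
def Pfun (X : Matrix (Fin 3 → Q) (Fin 3 → Q) ℂ) (f : Q → Q) : Prop :=
  ∀ w z, X w (f ∘ z) = ∑ w', if f ∘ w' = w then X w' z else 0

theorem Pfun.comp {X : Matrix (Fin 3 → Q) (Fin 3 → Q) ℂ} {f g : Q → Q} (hf : Pfun X f)
    (hg : Pfun X g) : Pfun X (f ∘ g) := by
  intro w z
  rw [Function.comp_assoc, hf]
  have : ∀ w', (if f ∘ w' = w then X w' (g ∘ z) else 0)
      = ∑ w'', if f ∘ w' = w then (if g ∘ w'' = w' then X w'' z else 0) else 0 := by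
    intro w'
    split_ifs
    · exact hg w' z
    · simp
  rw [Finset.sum_congr rfl fun w' _ => this w', Finset.sum_comm]
  refine Finset.sum_congr rfl fun w'' _ => ?_
  rw [Finset.sum_eq_single (g ∘ w'')]
  · rw [if_pos rfl, Function.comp_assoc]
  · intro w' _ h
    rw [if_neg (Ne.symm h), ite_self]
  · simp

theorem sw_generic (X : Matrix (Fin 3 → Q) (Fin 3 → Q) ℂ) (b : Fin 3 → Q)
    (hinj : Function.Injective b) (hb : ∀ w, X w b ≠ 0 → ∃ π : Equiv.Perm (Fin 3), w = b ∘ π)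
    (hz : ∀ z : Fin 3 → Q, ∃ f, Pfun X f ∧ f ∘ b = z) (w z : Fin 3 → Q) :
    X w z = ∑ π : Equiv.Perm (Fin 3), if w = z ∘ π then X (b ∘ π) b else 0 := by
  obtain ⟨f, hf, rfl⟩ := hz z
  rw [hf]
  symm
  apply Fintype.sum_of_injective (fun π : Equiv.Perm (Fin 3) => b ∘ π)
  · intro π π' h
    ext a
    exact congrArg _ (hinj (congrFun h a))
  · intro w' hw'
    by_contra hne
    have : X w' b ≠ 0 := by
      intro h0
      apply hne
      rw [h0, ite_self]
    obtain ⟨π, hπ⟩ := hb w' this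
    exact hw' ⟨π, hπ.symm⟩
  · intro π
    simp only [Function.comp_assoc, eq_comm]

theorem perm_commutes (X : Matrix (Fin 3 → Q) (Fin 3 → Q) ℂ) (c : Equiv.Perm (Fin 3) → ℂ)
    (hX : ∀ w z, X w z = ∑ π : Equiv.Perm (Fin 3), if w = z ∘ π then c π else 0)
    (A : Matrix Q Q ℂ) : tensorPow 3 A * X = X * tensorPow 3 A := by
  ext w z
  rw [Matrix.mul_apply, Matrix.mul_apply]
  simp only [hX, Finset.mul_sum, Finset.sum_mul]
  rw [Finset.sum_comm]
  conv_rhs => rw [Finset.sum_comm]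
  refine Finset.sum_congr rfl fun π _ => ?_
  rw [Finset.sum_eq_single (z ∘ π), Finset.sum_eq_single (w ∘ π.symm)]
  · have h1 : w = (w ∘ π.symm) ∘ π := by funext a; simp
    rw [if_pos rfl, if_pos h1]
    conv_lhs => rw [h1, tensorPow_perm]
    ring
  · intro v _ hv
    rw [if_neg, zero_mul]
    rintro rfl
    apply hv
    funext a; simp
  · simp
  · intro v _ hv
    rw [if_neg hv, mul_zero]
  · simp

/-- substitution matrix -/
def subst (f : Q → Q) : Matrix Q Q ℂ := fun p q => if p = f q then 1 else 0

theorem tensorPow_subst (f : Q → Q) (x y : Fin 3 → Q) :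
    tensorPow 3 (subst f) x y = if x = f ∘ y then 1 else 0 := by
  simp only [tensorPow, subst]
  rw [Finset.prod_ite_zero]
  simp [funext_iff]

theorem Pfun_iff (X : Matrix (Fin 3 → Q) (Fin 3 → Q) ℂ) (f : Q → Q) :
    Pfun X f ↔ tensorPow 3 (subst f) * X = X * tensorPow 3 (subst f) := by
  rw [← Matrix.ext_iff]
  simp only [Matrix.mul_apply, tensorPow_subst, Pfun]
  refine forall_congr' fun w => forall_congr' fun z => ?_
  simp only [ite_mul, mul_ite, one_mul, mul_one, zero_mul, mul_zero, Finset.sum_ite_eq',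
    Finset.sum_ite_eq, Finset.mem_univ, if_true]
  simp only [eq_comm]

theorem tensorPow_diagonal (d : Q → ℂ) (x y : Fin 3 → Q) :
    tensorPow 3 (Matrix.diagonal d) x y = if x = y then ∏ a, d (x a) else 0 := by
  simp only [tensorPow, Matrix.diagonal_apply]
  rw [Finset.prod_ite_zero]
  simp [funext_iff]

theorem diag_comm_iff (X : Matrix (Fin 3 → Q) (Fin 3 → Q) ℂ) (d : Q → ℂ) :
    tensorPow 3 (Matrix.diagonal d) * X = X * tensorPow 3 (Matrix.diagonal d) ↔
      ∀ w z, (∏ a, d (w a)) * X w z = X w z * ∏ a, d (z a) := by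
  rw [← Matrix.ext_iff]
  simp only [Matrix.mul_apply, tensorPow_diagonal]
  refine forall_congr' fun w => forall_congr' fun z => ?_
  simp only [ite_mul, mul_ite, zero_mul, mul_zero, Finset.sum_ite_eq',
    Finset.sum_ite_eq, Finset.mem_univ, if_true]

theorem I_pow_inj {a b : ℕ} (ha : a ≤ 3) (hb : b ≤ 3) (h : Complex.I ^ a = Complex.I ^ b) :
    a = b := by
  have h3 : Complex.I ^ 3 = -Complex.I := by rw [pow_succ, Complex.I_sq]; ring
  have e1 := congrArg Complex.re h
  have e2 := congrArg Complex.im h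
  interval_cases a <;> interval_cases b <;> 
    first | rfl | (exfalso; norm_num [h3] at e1; done) | (exfalso; norm_num [h3] at e2; done)

theorem diag_unitary (d : Q → ℂ) (hd : ∀ q, d q * star (d q) = 1) :
    Matrix.diagonal d ∈ Matrix.unitaryGroup Q ℂ := by
  rw [Matrix.mem_unitaryGroup_iff, Matrix.star_eq_conjTranspose, Matrix.diagonal_conjTranspose,
    Matrix.diagonal_mul_diagonal, ← Matrix.diagonal_one]
  congr 1
  funext q
  exact hd q

theorem support_perm (X : Matrix (Fin 3 → Q) (Fin 3 → Q) ℂ)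
    (hX : ∀ U ∈ Matrix.unitaryGroup Q ℂ, tensorPow 3 U * X = X * tensorPow 3 U)
    (w z : Fin 3 → Q) (h : X w z ≠ 0) : ∃ π : Equiv.Perm (Fin 3), w = z ∘ π := by
  have hcard : ∀ q, (Finset.univ.filter fun a => w a = q).card
      = (Finset.univ.filter fun a => z a = q).card := by
    intro q
    have hu : Matrix.diagonal (fun p => if p = q then Complex.I else 1)
        ∈ Matrix.unitaryGroup Q ℂ := by
      apply diag_unitary
      intro p
      split_ifs <;> simp
    have h1 := (diag_comm_iff X _).1 (hX _ hu) w z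
    rw [mul_comm] at h1
    have h2 := mul_left_cancel₀ h h1
    simp only [Finset.prod_ite, Finset.prod_const, one_pow, mul_one] at h2
    refine I_pow_inj ?_ ?_ h2 <;> exact (Finset.card_filter_le _ _).trans (by simp)
  have e : ∀ q, Nonempty ({a // w a = q} ≃ {a // z a = q}) := by
    intro q
    refine ⟨Fintype.equivOfCardEq ?_⟩
    rw [Fintype.card_subtype, Fintype.card_subtype]
    exact hcard q
  refine ⟨Equiv.ofFiberEquiv (fun q => (e q).some), ?_⟩
  funext a
  exact (Equiv.ofFiberEquiv_map _ a).symm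

theorem diag_comm_all (X : Matrix (Fin 3 → Q) (Fin 3 → Q) ℂ)
    (hX : ∀ U ∈ Matrix.unitaryGroup Q ℂ, tensorPow 3 U * X = X * tensorPow 3 U) (d : Q → ℂ) :
    tensorPow 3 (Matrix.diagonal d) * X = X * tensorPow 3 (Matrix.diagonal d) := by
  rw [diag_comm_iff]
  intro w z
  by_cases h : X w z = 0
  · rw [h]; ring
  · obtain ⟨π, rfl⟩ := support_perm X hX w z h
    rw [mul_comm]
    congr 1
    exact Equiv.prod_comp π (fun a => d (z a))

theorem subst_perm_unitary (σ : Equiv.Perm Q) : subst σ ∈ Matrix.unitaryGroup Q ℂ := by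
  rw [Matrix.mem_unitaryGroup_iff, Matrix.star_eq_conjTranspose]
  ext p q
  rw [Matrix.mul_apply]
  simp only [Matrix.conjTranspose_apply, subst, Matrix.one_apply]
  rw [Finset.sum_eq_single (σ.symm p)]
  · simp [eq_comm]
  · intro r _ hr
    rw [if_neg, zero_mul]
    rintro rfl
    simp at hr
  · simp

/-- A reflection on two coordinates. -/
noncomputable def refl4 : Matrix (Fin 2 × Fin 2) (Fin 2 × Fin 2) ℂ := fun p q =>
  if p.1 = 0 ∧ q.1 = 0 then
    (if p.2 = 0 then (if q.2 = 0 then 3/5 else 4/5) else (if q.2 = 0 then 4/5 else -(3/5)))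
  else if p = q then 1 else 0

theorem refl4_unitary : refl4 ∈ Matrix.unitaryGroup (Fin 2 × Fin 2) ℂ := by
  rw [Matrix.mem_unitaryGroup_iff, Matrix.star_eq_conjTranspose]
  ext ⟨a, b⟩ ⟨c, d⟩
  rw [Matrix.mul_apply, Fintype.sum_prod_type]
  simp only [Fin.sum_univ_two, Matrix.conjTranspose_apply, refl4, Matrix.one_apply]
  fin_cases a <;> fin_cases b <;> fin_cases c <;> fin_cases d <;> norm_num

/-- collapse `(0,1)` to `(0,0)` -/
def coll : Fin 2 × Fin 2 → Fin 2 × Fin 2 := fun p => if p = (0, 1) then (0, 0) else p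

theorem subst_coll : subst coll = Matrix.diagonal (fun p => if p = (0, 1) then 0 else 1) *
    refl4 * Matrix.diagonal (fun p => if p = (0, 0) then 5/3 else if p = (0,1) then 5/4 else 1) := by
  ext ⟨a, b⟩ ⟨c, d⟩
  rw [Matrix.mul_diagonal, Matrix.diagonal_mul]
  simp only [subst, coll, refl4]
  fin_cases a <;> fin_cases b <;> fin_cases c <;> fin_cases d <;> norm_num

theorem ext_perm {b z : Fin 3 → Q} (hb : Function.Injective b) (hz : Function.Injective z) :
    ∃ σ : Equiv.Perm Q, σ ∘ b = z := by
  classical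
  refine ⟨Equiv.extendSubtype
    ((Equiv.ofInjective b hb).symm.trans (Equiv.ofInjective z hz)), ?_⟩
  funext a
  simp only [Function.comp]
  rw [Equiv.extendSubtype_apply_of_mem _ _ ⟨a, rfl⟩]
  simp

theorem sw4 (X : Matrix (Fin 3 → Fin 2 × Fin 2) (Fin 3 → Fin 2 × Fin 2) ℂ)
    (hX : ∀ U ∈ Matrix.unitaryGroup (Fin 2 × Fin 2) ℂ,
      tensorPow 3 U * X = X * tensorPow 3 U) (w z) :
    X w z = ∑ π : Equiv.Perm (Fin 3), if w = z ∘ π then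
      X (![(0,0),(0,1),(1,0)] ∘ π) ![(0,0),(0,1),(1,0)] else 0 := by
  have hinj : Function.Injective (![(0,0),(0,1),(1,0)] : Fin 3 → Fin 2 × Fin 2) := by decide
  refine sw_generic X _ hinj
    (fun w h => support_perm X hX w _ h) ?_ w z
  have hperm : ∀ σ : Equiv.Perm (Fin 2 × Fin 2), Pfun X σ := fun σ =>
    (Pfun_iff X σ).2 (hX _ (subst_perm_unitary σ))
  have hcoll : Pfun X coll := by
    rw [Pfun_iff, subst_coll, tensorPow_mul, tensorPow_mul, mul_assoc, diag_comm_all X hX,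
      ← mul_assoc, mul_assoc (tensorPow 3 (Matrix.diagonal _)), hX _ refl4_unitary,
      ← mul_assoc, diag_comm_all X hX]
    simp only [mul_assoc]
  have hc : ∀ u v : Fin 2 × Fin 2, u ≠ v → Pfun X (fun p => if p = v then u else p) := by
    intro u v huv
    have hτ : ∃ τ : Equiv.Perm (Fin 2 × Fin 2), τ (0,0) = u ∧ τ (0,1) = v := by
      have : ∃ t, t ≠ u ∧ t ≠ v := by revert u v; decide
      obtain ⟨t, h1, h2⟩ := this
      obtain ⟨τ, hτ⟩ := ext_perm (z := ![u, v, t]) hinj (by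
        intro a b hab
        fin_cases a <;> fin_cases b <;> simp_all)
      exact ⟨τ, congrFun hτ 0, congrFun hτ 1⟩
    obtain ⟨τ, h0, h1⟩ := hτ
    have := ((hperm τ).comp hcoll).comp (hperm τ.symm)
    convert this using 1
    funext p
    simp only [Function.comp, coll]
    by_cases hp : p = v
    · rw [if_pos hp, if_pos, h0]
      rw [hp, ← h1, Equiv.symm_apply_apply]
    · rw [if_neg hp, if_neg, Equiv.apply_symm_apply]
      intro h
      apply hp
      rw [← h1, ← h, Equiv.apply_symm_apply]
  set R : (Fin 3 → Fin 2 × Fin 2) → Prop := fun z =>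
    ∃ f, Pfun X f ∧ f ∘ (![(0,0),(0,1),(1,0)] : Fin 3 → Fin 2 × Fin 2) = z with hR
  have hstep : ∀ (z : Fin 3 → Fin 2 × Fin 2) (a a' : Fin 3) (v : Fin 2 × Fin 2), a ≠ a' →
      z a = z a' → (∀ c, z c ≠ v) → R (Function.update z a' v) → R z := by
    rintro z a a' v haa hz hv ⟨f, hf, hfz⟩
    refine ⟨_, (hc (z a) v (hv a)).comp hf, ?_⟩
    rw [Function.comp_assoc, hfz]
    funext c
    simp only [Function.comp]
    by_cases h : c = a'
    · subst h; simp [hz]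
    · rw [Function.update_of_ne h, if_neg (hv c)]
  have hex : ∀ z : Fin 3 → Fin 2 × Fin 2, ∃ v, ∀ c, z c ≠ v := by
    intro z
    by_contra! hcon
    have := Fintype.card_le_of_surjective z hcon
    simp at this
  have L1 : ∀ z : Fin 3 → Fin 2 × Fin 2, z 0 ≠ z 1 → z 0 ≠ z 2 → z 1 ≠ z 2 → R z := by
    intro z h01 h02 h12
    obtain ⟨τ, hτ⟩ := ext_perm (z := z) hinj (by
        intro a b hab
        fin_cases a <;> fin_cases b <;> simp_all)
    exact ⟨τ, hperm τ, hτ⟩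
  have L2 : ∀ z : Fin 3 → Fin 2 × Fin 2, z 0 ≠ z 1 → z 0 ≠ z 2 → R z := by
    intro z h01 h02
    by_cases h12 : z 1 = z 2
    · obtain ⟨v, hv⟩ := hex z
      refine hstep z 1 2 v (by decide) h12 hv (L1 _ ?_ ?_ ?_) <;> simp [hv, h01]
    · exact L1 z h01 h02 h12
  have L3 : ∀ z : Fin 3 → Fin 2 × Fin 2, z 0 ≠ z 1 → R z := by
    intro z h01
    by_cases h12 : z 0 = z 2
    · obtain ⟨v, hv⟩ := hex z
      refine hstep z 0 2 v (by decide) h12 hv (L2 _ ?_ ?_) <;> simp [hv, h01]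
    · exact L2 z h01 h12
  intro z
  by_cases h12 : z 0 = z 1
  · obtain ⟨v, hv⟩ := hex z
    refine hstep z 0 1 v (by decide) h12 hv (L3 _ ?_)
    simp [hv]
  · exact L3 z h12

end SchurWeyl

section Structure

variable {n : ℕ}

/-- The third-moment commutant of the gates on qubits `i`, `j`. -/
noncomputable def Fij (i j : Fin n) : Submodule ℂ
    (EuclideanSpace ℂ ((Fin 3 → Fin n → Fin 2) × (Fin 3 → Fin n → Fin 2))) :=
  commE (Set.range fun U : Matrix.unitaryGroup (Fin 2 × Fin 2) ℂ =>
    tensorPow 3 (pairGate n i j (U : Matrix (Fin 2 × Fin 2) (Fin 2 × Fin 2) ℂ)))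

/-- The structure of the elements of `Fij`. -/
def Struct (i j : Fin n) (X : Matrix (Fin 3 → Fin n → Fin 2) (Fin 3 → Fin n → Fin 2) ℂ)
    (c : Equiv.Perm (Fin 3) → (Fin 3 → Fin n → Fin 2) → (Fin 3 → Fin n → Fin 2) → ℂ) : Prop :=
  (∀ π x y r r', c π (mrg3 i j x r) (mrg3 i j y r') = c π x y) ∧
    ∀ x y, X x y = ∑ π : Equiv.Perm (Fin 3), if rst3 i j x = rst3 i j y ∘ π then c π x y else 0

theorem mem_Fij {i j : Fin n} (X : Matrix (Fin 3 → Fin n → Fin 2) (Fin 3 → Fin n → Fin 2) ℂ) :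
    matE _ X ∈ Fij i j ↔ ∀ U ∈ Matrix.unitaryGroup (Fin 2 × Fin 2) ℂ,
      tensorPow 3 (pairGate n i j U) * X = X * tensorPow 3 (pairGate n i j U) := by
  rw [Fij, mem_commE]
  constructor
  · intro h U hU
    exact h _ ⟨⟨U, hU⟩, rfl⟩
  · rintro h _ ⟨U, rfl⟩
    exact h U U.2

theorem struct_of_mem {i j : Fin n} (h : i ≠ j)
    (X : Matrix (Fin 3 → Fin n → Fin 2) (Fin 3 → Fin n → Fin 2) ℂ) (hX : matE _ X ∈ Fij i j) :
    ∃ c, Struct i j X c := by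
  rw [mem_Fij] at hX
  refine ⟨fun π x y => X (mrg3 i j x (![(0,0),(0,1),(1,0)] ∘ π)) (mrg3 i j y ![(0,0),(0,1),(1,0)]),
    ?_, ?_⟩
  · intro π x y r r'
    simp only [mrg3_mrg3]
  · intro x y
    have := sw4 (Matrix.of fun r r' => X (mrg3 i j x r) (mrg3 i j y r')) ?_ (rst3 i j x) (rst3 i j y)
    · simp only [Matrix.of_apply] at this
      rw [mrg3_rst3, mrg3_rst3] at this
      exact this
    · intro U hU
      ext s s'
      have h1 := (comm_iff h U X).1 (hX U hU) (mrg3 i j x s) (mrg3 i j y s')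
      simp only [mrg3_mrg3, rst3_mrg3 h] at h1
      rw [Matrix.mul_apply, Matrix.mul_apply]
      exact h1

theorem mem_of_struct {i j : Fin n} (h : i ≠ j)
    (X : Matrix (Fin 3 → Fin n → Fin 2) (Fin 3 → Fin n → Fin 2) ℂ) (c) (hc : Struct i j X c)
    (U : Matrix (Fin 2 × Fin 2) (Fin 2 × Fin 2) ℂ) :
    tensorPow 3 (pairGate n i j U) * X = X * tensorPow 3 (pairGate n i j U) := by
  obtain ⟨h1, h2⟩ := hc
  have hl : ∀ π x y r, c π (mrg3 i j x r) y = c π x y := by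
    intro π x y r
    conv_lhs => rw [← mrg3_rst3 i j y]
    exact h1 _ _ _ _ _
  have hr : ∀ π x y r, c π x (mrg3 i j y r) = c π x y := by
    intro π x y r
    conv_lhs => rw [← mrg3_rst3 i j x]
    exact h1 _ _ _ _ _
  rw [comm_iff h]
  intro x y
  have := congrFun (congrFun (perm_commutes
    (Matrix.of fun w z => ∑ π : Equiv.Perm (Fin 3), if w = z ∘ π then c π x y else 0)
    (fun π => c π x y) (fun _ _ => rfl) U) (rst3 i j x)) (rst3 i j y)
  rw [Matrix.mul_apply, Matrix.mul_apply] at this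
  simp only [h2, rst3_mrg3 h, hl, hr]
  exact this

theorem mem_Fij_iff {i j : Fin n} (h : i ≠ j)
    (X : Matrix (Fin 3 → Fin n → Fin 2) (Fin 3 → Fin n → Fin 2) ℂ) :
    matE _ X ∈ Fij i j ↔ ∃ c, Struct i j X c :=
  ⟨struct_of_mem h X, fun ⟨c, hc⟩ => (mem_Fij X).2 fun U _ => mem_of_struct h X c hc U⟩

end Structure

section Blocks

theorem blockA_lower (x0 x1 x2 : ℝ) :
    0 ≤ ((1)*x0^2 + (5)*x1^2 + (15)*x2^2) / 2 + ((2)*(x0*x1) + (1)*(x1*x1) + (6)*(x1*x2) +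
      (12)*(x2*x2)) := by
  have h : ((1)*x0^2 + (5)*x1^2 + (15)*x2^2) / 2 + ((2)*(x0*x1) + (1)*(x1*x1) + (6)*(x1*x2) +
      (12)*(x2*x2)) = (1/2)*((1)*x0 + (2)*x1)^2 + (3/2)*((1)*x1 + (2)*x2)^2 +
      (27/2)*((1)*x2)^2 := by
    ring
  rw [h]
  positivity

theorem blockA_upper (x0 x1 x2 : ℝ) (hc : (1)*x0 + (5)*x1 + (15)*x2 = 0) :
    0 ≤ ((1)*x0^2 + (5)*x1^2 + (15)*x2^2) / 2 - ((2)*(x0*x1) + (1)*(x1*x1) + (6)*(x1*x2) +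
      (12)*(x2*x2)) := by
  have h0 : x0 = -((5)*x1 + (15)*x2) := by linarith
  have h : ((1)*x0^2 + (5)*x1^2 + (15)*x2^2) / 2 - ((2)*(x0*x1) + (1)*(x1*x1) + (6)*(x1*x2) +
      (12)*(x2*x2)) = (24)*((1)*x1 + (33/16)*x2)^2 + (189/32)*((1)*x2)^2 := by
    rw [h0]
    ring
  rw [h]
  positivity

theorem blockO_lower (x0 x1 x2 x3 x4 x5 x6 x7 x8 : ℝ) :
    0 ≤ ((1)*x0^2 + (15)*x1^2 + (15)*x2^2 + (15)*x3^2 + (90)*x4^2 + (20)*x5^2 + (60)*x6^2 +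
      (60)*x7^2 + (60)*x8^2) / 2 + ((2)*(x0*x5) + (6)*(x1*x5) + (24)*(x1*x6) + (6)*(x2*x5) +
      (24)*(x2*x7) + (6)*(x3*x5) + (24)*(x3*x8) + (36)*(x4*x4) + (36)*(x4*x6) + (36)*(x4*x7) +
      (36)*(x4*x8) + (1)*(x5*x5) + (6)*(x5*x6) + (6)*(x5*x7) + (6)*(x5*x8) + (9)*(x6*x6) +
      (18)*(x6*x7) + (18)*(x6*x8) + (9)*(x7*x7) + (18)*(x7*x8) + (9)*(x8*x8)) := by
  have h : ((1)*x0^2 + (15)*x1^2 + (15)*x2^2 + (15)*x3^2 + (90)*x4^2 + (20)*x5^2 + (60)*x6^2 +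
      (60)*x7^2 + (60)*x8^2) / 2 + ((2)*(x0*x5) + (6)*(x1*x5) + (24)*(x1*x6) + (6)*(x2*x5) +
      (24)*(x2*x7) + (6)*(x3*x5) + (24)*(x3*x8) + (36)*(x4*x4) + (36)*(x4*x6) + (36)*(x4*x7) +
      (36)*(x4*x8) + (1)*(x5*x5) + (6)*(x5*x6) + (6)*(x5*x7) + (6)*(x5*x8) + (9)*(x6*x6) +
      (18)*(x6*x7) + (18)*(x6*x8) + (9)*(x7*x7) + (18)*(x7*x8) + (9)*(x8*x8)) = (1/2)*((1)*x0 +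
      (2)*x5)^2 + (15/2)*((1)*x1 + (2/5)*x5 + (8/5)*x6)^2 + (15/2)*((1)*x2 + (2/5)*x5 +
      (8/5)*x7)^2 + (15/2)*((1)*x3 + (2/5)*x5 + (8/5)*x8)^2 + (81)*((1)*x4 + (2/9)*x6 +
      (2/9)*x7 + (2/9)*x8)^2 + (27/5)*((1)*x5 + (-1/3)*x6 + (-1/3)*x7 + (-1/3)*x8)^2 +
      (76/5)*((1)*x6 + (11/38)*x7 + (11/38)*x8)^2 + (1323/95)*((1)*x7 + (11/49)*x8)^2 +
      (648/49)*((1)*x8)^2 := by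
    ring
  rw [h]
  positivity

theorem blockO_upper (x0 x1 x2 x3 x4 x5 x6 x7 x8 : ℝ) (hc : (1)*x0 + (15)*x1 + (15)*x2 +
      (15)*x3 + (90)*x4 + (20)*x5 + (60)*x6 + (60)*x7 + (60)*x8 = 0) :
    0 ≤ ((1)*x0^2 + (15)*x1^2 + (15)*x2^2 + (15)*x3^2 + (90)*x4^2 + (20)*x5^2 + (60)*x6^2 +
      (60)*x7^2 + (60)*x8^2) / 2 - ((2)*(x0*x5) + (6)*(x1*x5) + (24)*(x1*x6) + (6)*(x2*x5) +
      (24)*(x2*x7) + (6)*(x3*x5) + (24)*(x3*x8) + (36)*(x4*x4) + (36)*(x4*x6) + (36)*(x4*x7) +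
      (36)*(x4*x8) + (1)*(x5*x5) + (6)*(x5*x6) + (6)*(x5*x7) + (6)*(x5*x8) + (9)*(x6*x6) +
      (18)*(x6*x7) + (18)*(x6*x8) + (9)*(x7*x7) + (18)*(x7*x8) + (9)*(x8*x8)) := by
  have h0 : x0 = -((15)*x1 + (15)*x2 + (15)*x3 + (90)*x4 + (20)*x5 + (60)*x6 + (60)*x7 +
      (60)*x8) := by linarith
  have h : ((1)*x0^2 + (15)*x1^2 + (15)*x2^2 + (15)*x3^2 + (90)*x4^2 + (20)*x5^2 + (60)*x6^2 +
      (60)*x7^2 + (60)*x8^2) / 2 - ((2)*(x0*x5) + (6)*(x1*x5) + (24)*(x1*x6) + (6)*(x2*x5) +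
      (24)*(x2*x7) + (6)*(x3*x5) + (24)*(x3*x8) + (36)*(x4*x4) + (36)*(x4*x6) + (36)*(x4*x7) +
      (36)*(x4*x8) + (1)*(x5*x5) + (6)*(x5*x6) + (6)*(x5*x7) + (6)*(x5*x8) + (9)*(x6*x6) +
      (18)*(x6*x7) + (18)*(x6*x8) + (9)*(x7*x7) + (18)*(x7*x8) + (9)*(x8*x8)) = (120)*((1)*x1 +
      (15/16)*x2 + (15/16)*x3 + (45/8)*x4 + (27/20)*x5 + (73/20)*x6 + (15/4)*x7 +
      (15/4)*x8)^2 + (465/32)*((1)*x2 + (15/31)*x3 + (90/31)*x4 + (108/155)*x5 + (84/31)*x6 +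
      (172/155)*x7 + (60/31)*x8)^2 + (345/31)*((1)*x3 + (45/23)*x4 + (54/115)*x5 + (42/23)*x6 +
      (42/23)*x7 + (26/115)*x8)^2 + (2232/23)*((1)*x4 + (25/62)*x5 + (41/62)*x6 + (41/62)*x7 +
      (41/62)*x8)^2 + (777/155)*((1)*x5 + (21/37)*x6 + (21/37)*x7 + (21/37)*x8)^2 +
      (6372/185)*((1)*x6 + (81/118)*x7 + (81/118)*x8)^2 + (5373/295)*((1)*x7 + (81/199)*x8)^2 +
      (3024/199)*((1)*x8)^2 := by
    rw [h0]
    ring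
  rw [h]
  positivity

theorem blockE_lower (x0 x1 x2 x3 x4 x5 x6 x7 x8 x9 x10 : ℝ) :
    0 ≤ ((10)*x0^2 + (10)*x1^2 + (10)*x2^2 + (10)*x3^2 + (10)*x4^2 + (10)*x5^2 + (20)*x6^2 +
      (60)*x7^2 + (60)*x8^2 + (60)*x9^2 + (10)*x10^2) / 2 + ((4)*(x0*x2) + (4)*(x0*x6) +
      (12)*(x0*x7) + (4)*(x1*x4) + (4)*(x1*x6) + (12)*(x1*x7) + (4)*(x2*x6) + (12)*(x2*x8) +
      (4)*(x3*x5) + (4)*(x3*x6) + (12)*(x3*x8) + (4)*(x4*x6) + (12)*(x4*x9) + (4)*(x5*x6) +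
      (12)*(x5*x9) + (4)*(x6*x10) + (12)*(x7*x7) + (12)*(x7*x8) + (12)*(x7*x9) +
      (12)*(x7*x10) + (12)*(x8*x8) + (12)*(x8*x9) + (12)*(x8*x10) + (12)*(x9*x9) +
      (12)*(x9*x10) + (5)*(x10*x10)) := by
  have h : ((10)*x0^2 + (10)*x1^2 + (10)*x2^2 + (10)*x3^2 + (10)*x4^2 + (10)*x5^2 + (20)*x6^2 +
      (60)*x7^2 + (60)*x8^2 + (60)*x9^2 + (10)*x10^2) / 2 + ((4)*(x0*x2) + (4)*(x0*x6) +
      (12)*(x0*x7) + (4)*(x1*x4) + (4)*(x1*x6) + (12)*(x1*x7) + (4)*(x2*x6) + (12)*(x2*x8) +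
      (4)*(x3*x5) + (4)*(x3*x6) + (12)*(x3*x8) + (4)*(x4*x6) + (12)*(x4*x9) + (4)*(x5*x6) +
      (12)*(x5*x9) + (4)*(x6*x10) + (12)*(x7*x7) + (12)*(x7*x8) + (12)*(x7*x9) +
      (12)*(x7*x10) + (12)*(x8*x8) + (12)*(x8*x9) + (12)*(x8*x10) + (12)*(x9*x9) +
      (12)*(x9*x10) + (5)*(x10*x10)) = (5)*((1)*x0 + (2/5)*x2 + (2/5)*x6 + (6/5)*x7)^2 +
      (5)*((1)*x1 + (2/5)*x4 + (2/5)*x6 + (6/5)*x7)^2 + (21/5)*((1)*x2 + (2/7)*x6 + (-4/7)*x7 +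
      (10/7)*x8)^2 + (5)*((1)*x3 + (2/5)*x5 + (2/5)*x6 + (6/5)*x8)^2 + (21/5)*((1)*x4 +
      (2/7)*x6 + (-4/7)*x7 + (10/7)*x9)^2 + (21/5)*((1)*x5 + (2/7)*x6 + (-4/7)*x8 +
      (10/7)*x9)^2 + (46/7)*((1)*x6 + (-12/23)*x7 + (-12/23)*x8 + (-12/23)*x9 + (7/23)*x10)^2 +
      (3714/161)*((1)*x7 + (205/619)*x8 + (205/619)*x9 + (189/619)*x10)^2 +
      (88992/4333)*((1)*x8 + (205/824)*x9 + (189/824)*x10)^2 + (3969/206)*((1)*x9 +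
      (9/49)*x10)^2 + (270/49)*((1)*x10)^2 := by
    ring
  rw [h]
  positivity

theorem blockE_upper (x0 x1 x2 x3 x4 x5 x6 x7 x8 x9 x10 : ℝ) (hc : (1)*x0 + (1)*x1 + (1)*x2 +
      (1)*x3 + (1)*x4 + (1)*x5 + (2)*x6 + (6)*x7 + (6)*x8 + (6)*x9 + (4)*x10 = 0) :
    0 ≤ ((10)*x0^2 + (10)*x1^2 + (10)*x2^2 + (10)*x3^2 + (10)*x4^2 + (10)*x5^2 + (20)*x6^2 +
      (60)*x7^2 + (60)*x8^2 + (60)*x9^2 + (10)*x10^2) / 2 - ((4)*(x0*x2) + (4)*(x0*x6) +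
      (12)*(x0*x7) + (4)*(x1*x4) + (4)*(x1*x6) + (12)*(x1*x7) + (4)*(x2*x6) + (12)*(x2*x8) +
      (4)*(x3*x5) + (4)*(x3*x6) + (12)*(x3*x8) + (4)*(x4*x6) + (12)*(x4*x9) + (4)*(x5*x6) +
      (12)*(x5*x9) + (4)*(x6*x10) + (12)*(x7*x7) + (12)*(x7*x8) + (12)*(x7*x9) +
      (12)*(x7*x10) + (12)*(x8*x8) + (12)*(x8*x9) + (12)*(x8*x10) + (12)*(x9*x9) +
      (12)*(x9*x10) + (5)*(x10*x10)) := by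
  have h0 : x0 = -((1)*x1 + (1)*x2 + (1)*x3 + (1)*x4 + (1)*x5 + (2)*x6 + (6)*x7 + (6)*x8 +
      (6)*x9 + (4)*x10) := by linarith
  have h : ((10)*x0^2 + (10)*x1^2 + (10)*x2^2 + (10)*x3^2 + (10)*x4^2 + (10)*x5^2 + (20)*x6^2 +
      (60)*x7^2 + (60)*x8^2 + (60)*x9^2 + (10)*x10^2) / 2 - ((4)*(x0*x2) + (4)*(x0*x6) +
      (12)*(x0*x7) + (4)*(x1*x4) + (4)*(x1*x6) + (12)*(x1*x7) + (4)*(x2*x6) + (12)*(x2*x8) +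
      (4)*(x3*x5) + (4)*(x3*x6) + (12)*(x3*x8) + (4)*(x4*x6) + (12)*(x4*x9) + (4)*(x5*x6) +
      (12)*(x5*x9) + (4)*(x6*x10) + (12)*(x7*x7) + (12)*(x7*x8) + (12)*(x7*x9) +
      (12)*(x7*x10) + (12)*(x8*x8) + (12)*(x8*x9) + (12)*(x8*x10) + (12)*(x9*x9) +
      (12)*(x9*x10) + (5)*(x10*x10)) = (10)*((1)*x1 + (7/10)*x2 + (1/2)*x3 + (3/10)*x4 +
      (1/2)*x5 + (1)*x6 + (3)*x7 + (3)*x8 + (3)*x9 + (2)*x10)^2 + (91/10)*((1)*x2 + (5/13)*x3 +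
      (7/13)*x4 + (5/13)*x5 + (10/13)*x6 + (270/91)*x7 + (150/91)*x8 + (30/13)*x9 +
      (20/13)*x10)^2 + (80/13)*((1)*x3 + (21/80)*x4 + (-11/80)*x5 + (3/8)*x6 + (69/40)*x7 +
      (21/40)*x8 + (9/8)*x9 + (3/4)*x10)^2 + (483/80)*((1)*x4 + (7/23)*x5 + (10/23)*x6 +
      (258/161)*x7 + (2)*x8 + (50/161)*x9 + (20/23)*x10)^2 + (126/23)*((1)*x5 + (1/3)*x6 +
      (5/3)*x7 + (23/21)*x8 + (5/21)*x9 + (2/3)*x10)^2 + (20)*((1)*x6 + (11/10)*x7 +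
      (11/10)*x8 + (11/10)*x9 + (1/2)*x10)^2 + (933/35)*((1)*x7 + (191/311)*x8 + (191/311)*x9 +
      (35/311)*x10)^2 + (36144/2177)*((1)*x8 + (191/502)*x9 + (35/502)*x10)^2 +
      (3564/251)*((1)*x9 + (5/99)*x10)^2 + (28/11)*((1)*x10)^2 := by
    rw [h0]
    ring
  rw [h]
  positivity

end Blocks

section ThreeSiteForm

/-- squared norms of the site basis -/
def nrm5 : Fin 5 → ℝ := ![8, 24, 24, 24, 12]

/-- index of the two-site basis vector containing a product of site basis vectors -/
def kI : Fin 5 → Fin 5 → Fin 6 :=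
  ![![0, 1, 2, 3, 5], ![1, 1, 4, 4, 5], ![2, 4, 2, 4, 5], ![3, 4, 4, 3, 5], ![5, 5, 5, 5, 4]]

/-- coefficient of the product in the two-site basis vector -/
def kC : Fin 5 → Fin 5 → ℝ :=
  ![![1, 1, 1, 1, 1], ![1, 1, 1, 1, 1], ![1, 1, 1, 1, 1], ![1, 1, 1, 1, 1], ![1, 1, 1, 1, 4]]

/-- the overlap form -/
def Bf (u v : Fin 6 → Fin 5 → ℝ) : ℝ :=
  ∑ a, ∑ b, ∑ c, nrm5 a * nrm5 b * nrm5 c * ((kC a b * u (kI a b) c) * (kC b c * v (kI b c) a))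

/-- the norm form -/
def Wf (u : Fin 6 → Fin 5 → ℝ) : ℝ :=
  ∑ a, ∑ b, ∑ c, nrm5 a * nrm5 b * nrm5 c * (kC a b * u (kI a b) c) ^ 2

/-- coefficients of the permutations in the site basis -/
noncomputable def pcoef : Fin 6 → Fin 5 → ℝ :=
  ![![1, 0, 0, 0, 0], ![1/2, 1/2, 0, 0, 0], ![1/2, 0, 1/2, 0, 0], ![1/2, 0, 0, 1/2, 0],
    ![1/4, 1/4, 1/4, 1/4, 1/2], ![1/4, 1/4, 1/4, 1/4, -1/2]]

/-- the constraint functional -/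
noncomputable def Cf (i : Fin 6) (u : Fin 6 → Fin 5 → ℝ) : ℝ :=
  ∑ a, ∑ b, ∑ c, nrm5 a * nrm5 b * nrm5 c * (pcoef i a * pcoef i b * pcoef i c) *
    (kC a b * u (kI a b) c)

theorem Wf_eq (u : Fin 6 → Fin 5 → ℝ) : Wf u = 512 * u 0 0^2 + 1536 * u 0 1^2 +
      1536 * u 0 2^2 + 1536 * u 0 3^2 + 768 * u 0 4^2 + 7680 * u 1 0^2 + 23040 * u 1 1^2 +
      23040 * u 1 2^2 + 23040 * u 1 3^2 + 11520 * u 1 4^2 + 7680 * u 2 0^2 + 23040 * u 2 1^2 +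
      23040 * u 2 2^2 + 23040 * u 2 3^2 + 11520 * u 2 4^2 + 7680 * u 3 0^2 + 23040 * u 3 1^2 +
      23040 * u 3 2^2 + 23040 * u 3 3^2 + 11520 * u 3 4^2 + 46080 * u 4 0^2 +
      138240 * u 4 1^2 + 138240 * u 4 2^2 + 138240 * u 4 3^2 + 69120 * u 4 4^2 +
      15360 * u 5 0^2 + 46080 * u 5 1^2 + 46080 * u 5 2^2 + 46080 * u 5 3^2 +
      23040 * u 5 4^2 := by
  simp only [Wf, Fin.sum_univ_five, nrm5, kI, kC, Matrix.cons_val]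
  ring

theorem Bf_eq (u : Fin 6 → Fin 5 → ℝ) : Bf u u = 512 * (u 0 0 * u 0 0) +
      3072 * (u 0 1 * u 1 0) + 3072 * (u 0 2 * u 2 0) + 3072 * (u 0 3 * u 3 0) +
      1536 * (u 0 4 * u 5 0) + 1536 * (u 1 0 * u 1 0) + 9216 * (u 1 0 * u 1 1) +
      18432 * (u 1 1 * u 1 1) + 9216 * (u 1 2 * u 2 1) + 9216 * (u 1 2 * u 4 0) +
      27648 * (u 1 2 * u 4 1) + 9216 * (u 1 3 * u 3 1) + 9216 * (u 1 3 * u 4 0) +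
      27648 * (u 1 3 * u 4 1) + 4608 * (u 1 4 * u 5 0) + 18432 * (u 1 4 * u 5 1) +
      1536 * (u 2 0 * u 2 0) + 9216 * (u 2 0 * u 2 2) + 9216 * (u 2 1 * u 4 0) +
      27648 * (u 2 1 * u 4 2) + 18432 * (u 2 2 * u 2 2) + 9216 * (u 2 3 * u 3 2) +
      9216 * (u 2 3 * u 4 0) + 27648 * (u 2 3 * u 4 2) + 4608 * (u 2 4 * u 5 0) +
      18432 * (u 2 4 * u 5 2) + 1536 * (u 3 0 * u 3 0) + 9216 * (u 3 0 * u 3 3) +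
      9216 * (u 3 1 * u 4 0) + 27648 * (u 3 1 * u 4 3) + 9216 * (u 3 2 * u 4 0) +
      27648 * (u 3 2 * u 4 3) + 18432 * (u 3 3 * u 3 3) + 4608 * (u 3 4 * u 5 0) +
      18432 * (u 3 4 * u 5 3) + 9216 * (u 4 0 * u 5 4) + 27648 * (u 4 1 * u 4 1) +
      27648 * (u 4 1 * u 4 2) + 27648 * (u 4 1 * u 4 3) + 27648 * (u 4 1 * u 5 4) +
      27648 * (u 4 2 * u 4 2) + 27648 * (u 4 2 * u 4 3) + 27648 * (u 4 2 * u 5 4) +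
      27648 * (u 4 3 * u 4 3) + 27648 * (u 4 3 * u 5 4) + 27648 * (u 4 4 * u 4 4) +
      27648 * (u 4 4 * u 5 1) + 27648 * (u 4 4 * u 5 2) + 27648 * (u 4 4 * u 5 3) +
      768 * (u 5 0 * u 5 0) + 4608 * (u 5 0 * u 5 1) + 4608 * (u 5 0 * u 5 2) +
      4608 * (u 5 0 * u 5 3) + 6912 * (u 5 1 * u 5 1) + 13824 * (u 5 1 * u 5 2) +
      13824 * (u 5 1 * u 5 3) + 6912 * (u 5 2 * u 5 2) + 13824 * (u 5 2 * u 5 3) +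
      6912 * (u 5 3 * u 5 3) + 11520 * (u 5 4 * u 5 4) := by
  simp only [Bf, Fin.sum_univ_five, nrm5, kI, kC, Matrix.cons_val]
  ring

theorem Cf_eq0 (u : Fin 6 → Fin 5 → ℝ) : Cf 0 u = (512) * u 0 0 := by
  simp only [Cf, Fin.sum_univ_five, nrm5, kI, kC, pcoef, Matrix.cons_val]
  ring

theorem Cf_eq1 (u : Fin 6 → Fin 5 → ℝ) : Cf 1 u = (64) * u 0 0 + (192) * u 0 1 +
      (960) * u 1 0 + (2880) * u 1 1 := by
  simp only [Cf, Fin.sum_univ_five, nrm5, kI, kC, pcoef, Matrix.cons_val]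
  ring

theorem Cf_eq2 (u : Fin 6 → Fin 5 → ℝ) : Cf 2 u = (64) * u 0 0 + (192) * u 0 2 +
      (960) * u 2 0 + (2880) * u 2 2 := by
  simp only [Cf, Fin.sum_univ_five, nrm5, kI, kC, pcoef, Matrix.cons_val]
  ring

theorem Cf_eq3 (u : Fin 6 → Fin 5 → ℝ) : Cf 3 u = (64) * u 0 0 + (192) * u 0 3 +
      (960) * u 3 0 + (2880) * u 3 3 := by
  simp only [Cf, Fin.sum_univ_five, nrm5, kI, kC, pcoef, Matrix.cons_val]
  ring

theorem Cf_eq4 (u : Fin 6 → Fin 5 → ℝ) : Cf 4 u = (8) * u 0 0 + (24) * u 0 1 + (24) * u 0 2 +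
      (24) * u 0 3 + (24) * u 0 4 + (120) * u 1 0 + (360) * u 1 1 + (360) * u 1 2 +
      (360) * u 1 3 + (360) * u 1 4 + (120) * u 2 0 + (360) * u 2 1 + (360) * u 2 2 +
      (360) * u 2 3 + (360) * u 2 4 + (120) * u 3 0 + (360) * u 3 1 + (360) * u 3 2 +
      (360) * u 3 3 + (360) * u 3 4 + (720) * u 4 0 + (2160) * u 4 1 + (2160) * u 4 2 +
      (2160) * u 4 3 + (2160) * u 4 4 + (480) * u 5 0 + (1440) * u 5 1 + (1440) * u 5 2 +
      (1440) * u 5 3 + (1440) * u 5 4 := by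
  simp only [Cf, Fin.sum_univ_five, nrm5, kI, kC, pcoef, Matrix.cons_val]
  ring

theorem Cf_eq5 (u : Fin 6 → Fin 5 → ℝ) : Cf 5 u = (8) * u 0 0 + (24) * u 0 1 + (24) * u 0 2 +
      (24) * u 0 3 + (-24) * u 0 4 + (120) * u 1 0 + (360) * u 1 1 + (360) * u 1 2 +
      (360) * u 1 3 + (-360) * u 1 4 + (120) * u 2 0 + (360) * u 2 1 + (360) * u 2 2 +
      (360) * u 2 3 + (-360) * u 2 4 + (120) * u 3 0 + (360) * u 3 1 + (360) * u 3 2 +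
      (360) * u 3 3 + (-360) * u 3 4 + (720) * u 4 0 + (2160) * u 4 1 + (2160) * u 4 2 +
      (2160) * u 4 3 + (-2160) * u 4 4 + (-480) * u 5 0 + (-1440) * u 5 1 + (-1440) * u 5 2 +
      (-1440) * u 5 3 + (1440) * u 5 4 := by
  simp only [Cf, Fin.sum_univ_five, nrm5, kI, kC, pcoef, Matrix.cons_val]
  ring

theorem Bf_bound (u : Fin 6 → Fin 5 → ℝ) (h : ∀ i, Cf i u = 0) :
    Bf u u ≤ Wf u / 2 ∧ -(Wf u / 2) ≤ Bf u u := by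
  have h0 := h 0
  have h1 := h 1
  have h2 := h 2
  have h3 := h 3
  have h4 := h 4
  have h5 := h 5
  rw [Cf_eq0] at h0
  rw [Cf_eq1] at h1
  rw [Cf_eq2] at h2
  rw [Cf_eq3] at h3
  rw [Cf_eq4] at h4
  rw [Cf_eq5] at h5
  have z : u 0 0 = 0 := by linarith
  rw [Wf_eq, Bf_eq]
  constructor
  · have e0 := blockA_upper (u 0 1) (u 1 0) (u 1 1) (by linarith)
    have e1 := blockA_upper (u 0 2) (u 2 0) (u 2 2) (by linarith)
    have e2 := blockA_upper (u 0 3) (u 3 0) (u 3 3) (by linarith)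
    have e3 := blockO_upper (u 0 4) (u 1 4) (u 2 4) (u 3 4) (u 4 4) (u 5 0) (u 5 1) (u 5 2) (u 5 3) (by linarith)
    have e4 := blockE_upper (u 1 2) (u 1 3) (u 2 1) (u 2 3) (u 3 1) (u 3 2) (u 4 0) (u 4 1) (u 4 2) (u 4 3) (u 5 4) (by linarith)
    rw [z]
    linarith
  · have e0 := blockA_lower (u 0 1) (u 1 0) (u 1 1)
    have e1 := blockA_lower (u 0 2) (u 2 0) (u 2 2)
    have e2 := blockA_lower (u 0 3) (u 3 0) (u 3 3)
    have e3 := blockO_lower (u 0 4) (u 1 4) (u 2 4) (u 3 4) (u 4 4) (u 5 0) (u 5 1) (u 5 2) (u 5 3)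
    have e4 := blockE_lower (u 1 2) (u 1 3) (u 2 1) (u 2 3) (u 3 1) (u 3 2) (u 4 0) (u 4 1) (u 4 2) (u 4 3) (u 5 4)
    rw [z]
    linarith

end ThreeSiteForm

section ThreeSite

theorem kC_symm (a b : Fin 5) : kC a b = kC b a := by
  fin_cases a <;> fin_cases b <;> rfl

theorem kI_symm (a b : Fin 5) : kI a b = kI b a := by
  revert a b; decide

theorem Bf_symm (u v : Fin 6 → Fin 5 → ℝ) : Bf u v = Bf v u := by
  unfold Bf
  rw [Finset.sum_comm]
  rw [Finset.sum_congr rfl fun b _ => Finset.sum_comm]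
  rw [Finset.sum_comm]
  refine Finset.sum_congr rfl fun a _ => Finset.sum_congr rfl fun b _ =>
    Finset.sum_congr rfl fun c _ => ?_
  rw [kC_symm c b, kI_symm c b, kC_symm b a, kI_symm b a]
  ring

theorem Bf_add (u v w : Fin 6 → Fin 5 → ℝ) : Bf (u + v) w = Bf u w + Bf v w := by
  simp only [Bf, ← Finset.sum_add_distrib, Pi.add_apply]
  refine Finset.sum_congr rfl fun a _ => Finset.sum_congr rfl fun b _ =>
    Finset.sum_congr rfl fun c _ => ?_
  ring

theorem Bf_sub (u v w : Fin 6 → Fin 5 → ℝ) : Bf (u - v) w = Bf u w - Bf v w := by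
  simp only [Bf, ← Finset.sum_sub_distrib, Pi.sub_apply]
  refine Finset.sum_congr rfl fun a _ => Finset.sum_congr rfl fun b _ =>
    Finset.sum_congr rfl fun c _ => ?_
  ring

theorem Wf_parallelogram (u v : Fin 6 → Fin 5 → ℝ) :
    Wf (u + v) + Wf (u - v) = 2 * Wf u + 2 * Wf v := by
  simp only [Wf, ← Finset.sum_add_distrib, Finset.mul_sum, Pi.sub_apply, Pi.add_apply]
  refine Finset.sum_congr rfl fun a _ => Finset.sum_congr rfl fun b _ =>
    Finset.sum_congr rfl fun c _ => ?_
  ring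

theorem Cf_add (i) (u v : Fin 6 → Fin 5 → ℝ) : Cf i (u + v) = Cf i u + Cf i v := by
  simp only [Cf, ← Finset.sum_add_distrib, Pi.add_apply]
  refine Finset.sum_congr rfl fun a _ => Finset.sum_congr rfl fun b _ =>
    Finset.sum_congr rfl fun c _ => ?_
  ring

theorem Cf_sub (i) (u v : Fin 6 → Fin 5 → ℝ) : Cf i (u - v) = Cf i u - Cf i v := by
  simp only [Cf, ← Finset.sum_sub_distrib, Pi.sub_apply]
  refine Finset.sum_congr rfl fun a _ => Finset.sum_congr rfl fun b _ =>
    Finset.sum_congr rfl fun c _ => ?_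
  ring

theorem Bf_polar (u v : Fin 6 → Fin 5 → ℝ) (hu : ∀ i, Cf i u = 0) (hv : ∀ i, Cf i v = 0) :
    Bf u v ≤ (Wf u + Wf v) / 4 := by
  have h1 := (Bf_bound (u + v) (fun i => by rw [Cf_add, hu, hv, add_zero])).1
  have h2 := (Bf_bound (u - v) (fun i => by rw [Cf_sub, hu, hv, sub_zero])).2
  have e1 : Bf (u + v) (u + v) = Bf u u + 2 * Bf u v + Bf v v := by
    rw [Bf_add, Bf_symm u, Bf_symm v, Bf_add, Bf_add, Bf_symm v u]; ring
  have e2 : Bf (u - v) (u - v) = Bf u u - 2 * Bf u v + Bf v v := by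
    rw [Bf_sub, Bf_symm u, Bf_symm v, Bf_sub, Bf_sub, Bf_symm v u]; ring
  have h3 := Wf_parallelogram u v
  linarith

/-- one site of the doubled triple system -/
abbrev Site := (Fin 3 → Fin 2) × (Fin 3 → Fin 2)

/-- the site vector of a permutation -/
def Pz (σ : Fin 3 → Fin 3) (s : Site) : ℤ := if ∀ a, s.1 a = s.2 (σ a) then 1 else 0

/-- the six permutations -/
def perm6 : Fin 6 → Fin 3 → Fin 3 :=
  ![![0, 1, 2], ![1, 0, 2], ![0, 2, 1], ![2, 1, 0], ![1, 2, 0], ![2, 0, 1]]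

/-- orthogonal site basis -/
def vz : Fin 5 → Site → ℤ :=
  ![fun s => Pz ![0, 1, 2] s, fun s => 2 * Pz ![1, 0, 2] s - Pz ![0, 1, 2] s,
    fun s => 2 * Pz ![0, 2, 1] s - Pz ![0, 1, 2] s,
    fun s => 2 * Pz ![2, 1, 0] s - Pz ![0, 1, 2] s,
    fun s => Pz ![1, 2, 0] s - Pz ![2, 0, 1] s]

theorem vz_gram : ∀ a b, ∑ s, vz a s * vz b s
    = if a = b then (![8, 24, 24, 24, 12] : Fin 5 → ℤ) a else 0 := by
  decide +kernel

theorem Pz_rel : ∀ s, Pz ![1, 2, 0] s + Pz ![2, 0, 1] s + Pz ![0, 1, 2] s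
    = Pz ![1, 0, 2] s + Pz ![0, 2, 1] s + Pz ![2, 1, 0] s := by
  decide +kernel

/-- real site basis -/
def vr (a : Fin 5) (s : Site) : ℝ := vz a s

/-- real site vectors -/
def Pr (i : Fin 6) (s : Site) : ℝ := Pz (perm6 i) s

theorem vr_gram (a b) : ∑ s, vr a s * vr b s = if a = b then nrm5 a else 0 := by
  have h := congrArg (fun z : ℤ => (z : ℝ)) (vz_gram a b)
  simp only [Int.cast_sum, Int.cast_mul] at h
  unfold vr
  rw [h]
  split_ifs
  · fin_cases a <;> simp [nrm5]
  · simp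

theorem Pr_eq (i) (s) : Pr i s = ∑ a, pcoef i a * vr a s := by
  have h := congrArg (fun z : ℤ => (z : ℝ)) (Pz_rel s)
  push_cast at h
  rw [Fin.sum_univ_five]
  fin_cases i <;> simp [Pr, perm6, pcoef, vr, vz] <;> linarith

/-- coefficients of the two-site permutations -/
noncomputable def bcoef : Fin 6 → Fin 6 → ℝ :=
  ![![1, 0, 0, 0, 0, 0], ![1/4, 1/4, 0, 0, 0, 0], ![1/4, 0, 1/4, 0, 0, 0],
    ![1/4, 0, 0, 1/4, 0, 0], ![1/16, 1/16, 1/16, 1/16, 1/16, 1/8],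
    ![1/16, 1/16, 1/16, 1/16, 1/16, -1/8]]

theorem pcoef_mul (i a b) : pcoef i a * pcoef i b = kC a b * bcoef i (kI a b) := by
  fin_cases i <;> fin_cases a <;> fin_cases b <;> simp [pcoef, kC, bcoef, kI] <;> norm_num

theorem ortho_sum (x y : Fin 5 → ℝ) :
    ∑ s, (∑ a, vr a s * x a) * (∑ b, vr b s * y b) = ∑ a, nrm5 a * x a * y a := by
  simp only [Finset.sum_mul_sum]
  rw [Finset.sum_comm]
  refine Finset.sum_congr rfl fun a _ => ?_
  rw [Finset.sum_comm]
  have : ∀ b, ∑ s, vr a s * x a * (vr b s * y b) = (if a = b then nrm5 a else 0) * (x a * y b) := by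
    intro b
    rw [← vr_gram, Finset.sum_mul]
    exact Finset.sum_congr rfl fun s _ => by ring
  simp only [this]
  simp [mul_assoc]

theorem nrm5_pos (a) : 0 < nrm5 a := by
  fin_cases a <;> simp [nrm5]

/-- coefficient of a site function -/
noncomputable def cf (F : Site → ℝ) (a : Fin 5) : ℝ := (∑ s, vr a s * F s) / nrm5 a

theorem cf_spec (F : Site → ℝ) (a : Fin 5) : ∑ s, vr a s * F s = nrm5 a * cf F a := by
  rw [cf, mul_div_cancel₀ _ (nrm5_pos a).ne']

theorem bessel (F : Site → ℝ) : ∑ a, nrm5 a * cf F a ^ 2 ≤ ∑ s, F s ^ 2 := by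
  have h : 0 ≤ ∑ s, (F s - ∑ a, vr a s * cf F a) ^ 2 := Finset.sum_nonneg fun s _ => sq_nonneg _
  have e : ∑ s, (F s - ∑ a, vr a s * cf F a) ^ 2
      = ∑ s, F s ^ 2 - 2 * ∑ s, (∑ a, vr a s * cf F a) * F s
        + ∑ s, (∑ a, vr a s * cf F a) * (∑ a, vr a s * cf F a) := by
    rw [Finset.mul_sum, ← Finset.sum_sub_distrib, ← Finset.sum_add_distrib]
    exact Finset.sum_congr rfl fun s _ => by ring
  have e2 : ∑ s, (∑ a, vr a s * cf F a) * F s = ∑ a, nrm5 a * cf F a ^ 2 := by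
    simp only [Finset.sum_mul]
    rw [Finset.sum_comm]
    refine Finset.sum_congr rfl fun a _ => ?_
    rw [sq, ← mul_assoc, ← cf_spec, Finset.sum_mul]
    exact Finset.sum_congr rfl fun s _ => by ring
  rw [ortho_sum] at e
  have e3 : ∑ a, nrm5 a * cf F a * cf F a = ∑ a, nrm5 a * cf F a ^ 2 :=
    Finset.sum_congr rfl fun s _ => by ring
  rw [e3, e2] at e
  linarith

/-- a three-site function, permutation-like on the first two sites -/
def fF (c : Fin 6 → Site → ℝ) (p q r : Site) : ℝ := ∑ i, Pr i p * Pr i q * c i r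

/-- coefficients in the two-site basis -/
noncomputable def cK (c : Fin 6 → Site → ℝ) (k : Fin 6) (r : Site) : ℝ := ∑ i, bcoef i k * c i r

theorem fF_eq (c : Fin 6 → Site → ℝ) (p q r : Site) :
    fF c p q r = ∑ b, vr b q * ∑ a, vr a p * (kC a b * cK c (kI a b) r) := by
  unfold fF cK
  simp only [Finset.mul_sum]
  rw [Finset.sum_congr rfl fun b _ => Finset.sum_comm, Finset.sum_comm]
  rw [Finset.sum_congr rfl fun b _ => Finset.sum_comm]
  have : ∀ i, Pr i p * Pr i q * c i r = ∑ a, ∑ b, vr b q * (vr a p * (kC a b *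
      (bcoef i (kI a b) * c i r))) := by
    intro i
    rw [Pr_eq, Pr_eq, Finset.sum_mul_sum, Finset.sum_mul]
    refine Finset.sum_congr rfl fun a _ => ?_
    rw [Finset.sum_mul]
    refine Finset.sum_congr rfl fun b _ => ?_
    have := pcoef_mul i a b
    calc _ = (pcoef i a * pcoef i b) * (vr a p * vr b q * c i r) := by ring
      _ = _ := by rw [this]; ring
  simp only [this]

/-- the reduced vector -/
noncomputable def uv (c : Fin 6 → Site → ℝ) (k : Fin 6) (g : Fin 5) : ℝ := cf (cK c k) g

theorem fF_norm (c : Fin 6 → Site → ℝ) :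
    Wf (uv c) ≤ ∑ p, ∑ q, ∑ r, fF c p q r ^ 2 := by
  have h1 : ∑ p, ∑ q, ∑ r, fF c p q r ^ 2
      = ∑ a, ∑ b, nrm5 a * nrm5 b * kC a b ^ 2 * ∑ r, cK c (kI a b) r ^ 2 := by
    rw [Finset.sum_congr rfl fun p _ => Finset.sum_comm, Finset.sum_comm]
    simp only [fF_eq, sq]
    simp only [ortho_sum]
    rw [Finset.sum_congr rfl fun r _ => Finset.sum_comm]
    have : ∀ r : Site, ∀ b, ∑ p, nrm5 b * (∑ a, vr a p * (kC a b * cK c (kI a b) r)) *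
        (∑ a, vr a p * (kC a b * cK c (kI a b) r))
        = ∑ a, nrm5 a * nrm5 b * (kC a b * kC a b) * (cK c (kI a b) r * cK c (kI a b) r) := by
      intro r b
      simp only [mul_assoc (nrm5 b)]
      rw [← Finset.mul_sum, ortho_sum, Finset.mul_sum]
      exact Finset.sum_congr rfl fun a _ => by ring
    simp only [this]
    simp only [Finset.mul_sum]
    rw [Finset.sum_comm, Finset.sum_congr rfl fun b _ => Finset.sum_comm, Finset.sum_comm]
  rw [h1]
  unfold Wf
  refine Finset.sum_le_sum fun a _ => Finset.sum_le_sum fun b _ => ?_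
  have h2 : ∑ g, nrm5 a * nrm5 b * nrm5 g * (kC a b * uv c (kI a b) g) ^ 2
      = nrm5 a * nrm5 b * kC a b ^ 2 * ∑ g, nrm5 g * cf (cK c (kI a b)) g ^ 2 := by
    rw [Finset.mul_sum]
    refine Finset.sum_congr rfl fun g _ => ?_
    unfold uv
    ring
  rw [h2]
  have := nrm5_pos a
  have := nrm5_pos b
  exact mul_le_mul_of_nonneg_left (bessel _) (by positivity)

theorem fF_constraint (c : Fin 6 → Site → ℝ) (i : Fin 6) :
    ∑ p, ∑ q, ∑ r, Pr i p * Pr i q * Pr i r * fF c p q r = Cf i (uv c) := by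
  have hP : ∀ p, Pr i p = ∑ a, vr a p * pcoef i a := by
    intro p; rw [Pr_eq]; exact Finset.sum_congr rfl fun a _ => mul_comm _ _
  rw [Finset.sum_congr rfl fun p _ => Finset.sum_comm, Finset.sum_comm]
  have h1 : ∀ r p, ∑ q, Pr i p * Pr i q * Pr i r * fF c p q r
      = ∑ b, Pr i r * nrm5 b * pcoef i b * (Pr i p *
        ∑ a, vr a p * (kC a b * cK c (kI a b) r)) := by
    intro r p
    have : ∀ q, Pr i p * Pr i q * Pr i r * fF c p q r
      = Pr i p * Pr i r * (Pr i q * fF c p q r) := fun q => by ring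
    simp only [this]
    rw [← Finset.mul_sum]
    simp only [fF_eq, hP _]
    rw [ortho_sum, Finset.mul_sum]
    exact Finset.sum_congr rfl fun b _ => by ring
  have h2 : ∀ r, ∑ p, ∑ q, Pr i p * Pr i q * Pr i r * fF c p q r
      = ∑ b, ∑ a, Pr i r * nrm5 b * pcoef i b * (nrm5 a * pcoef i a *
        (kC a b * cK c (kI a b) r)) := by
    intro r
    simp only [h1]
    rw [Finset.sum_comm]
    refine Finset.sum_congr rfl fun b _ => ?_
    rw [← Finset.mul_sum, ← Finset.mul_sum]
    congr 1
    simp only [hP _]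
    rw [ortho_sum]
  simp only [h2]
  rw [Finset.sum_comm, Finset.sum_congr rfl fun b _ => Finset.sum_comm, Finset.sum_comm]
  unfold Cf
  refine Finset.sum_congr rfl fun a _ => Finset.sum_congr rfl fun b _ => ?_
  have h3 : ∀ r, Pr i r * nrm5 b * pcoef i b * (nrm5 a * pcoef i a * (kC a b * cK c (kI a b) r))
      = ∑ g, nrm5 a * nrm5 b * (pcoef i a * pcoef i b * pcoef i g) * kC a b *
        (vr g r * cK c (kI a b) r) := by
    intro r
    rw [hP, Finset.sum_mul, Finset.sum_mul, Finset.sum_mul]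
    exact Finset.sum_congr rfl fun g _ => by ring
  simp only [h3]
  rw [Finset.sum_comm]
  refine Finset.sum_congr rfl fun g _ => ?_
  rw [← Finset.mul_sum, cf_spec]
  unfold uv
  ring

theorem fF_inner (c d : Fin 6 → Site → ℝ) :
    ∑ p, ∑ q, ∑ r, fF c p q r * fF d r q p = Bf (uv c) (uv d) := by
  rw [Finset.sum_congr rfl fun p _ => Finset.sum_comm]
  simp only [fF_eq, ortho_sum]
  have h1 : ∀ p r b, nrm5 b * (∑ a, vr a p * (kC a b * cK c (kI a b) r)) *
      (∑ a, vr a r * (kC a b * cK d (kI a b) p))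
      = ∑ a, ∑ g, nrm5 b * kC a b * kC b g * ((vr a p * cK d (kI b g) p) *
        (vr g r * cK c (kI a b) r)) := by
    intro p r b
    rw [mul_assoc, Finset.sum_mul_sum, Finset.mul_sum]
    refine Finset.sum_congr rfl fun a _ => ?_
    rw [Finset.mul_sum]
    refine Finset.sum_congr rfl fun g _ => ?_
    rw [kC_symm g b, kI_symm g b]
    ring
  simp only [h1]
  -- move the site sums inside
  have h2 : ∀ T : Site → Site → Fin 5 → Fin 5 → Fin 5 → ℝ,
      ∑ p, ∑ r, ∑ b, ∑ a, ∑ g, T p r b a g = ∑ a, ∑ b, ∑ g, ∑ p, ∑ r, T p r b a g := by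
    intro T
    have e1 : ∀ p, ∑ r, ∑ b, ∑ a, ∑ g, T p r b a g = ∑ a, ∑ b, ∑ g, ∑ r, T p r b a g := by
      intro p
      rw [Finset.sum_congr rfl fun r _ => Finset.sum_comm, Finset.sum_comm]
      refine Finset.sum_congr rfl fun a _ => ?_
      rw [Finset.sum_comm]
      refine Finset.sum_congr rfl fun b _ => ?_
      rw [Finset.sum_comm]
    simp only [e1]
    rw [Finset.sum_comm]
    refine Finset.sum_congr rfl fun a _ => ?_
    rw [Finset.sum_comm]
    refine Finset.sum_congr rfl fun b _ => ?_
    rw [Finset.sum_comm]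
  rw [h2]
  unfold Bf
  refine Finset.sum_congr rfl fun a _ => Finset.sum_congr rfl fun b _ =>
    Finset.sum_congr rfl fun g _ => ?_
  simp only [← Finset.mul_sum]
  rw [← Finset.sum_mul, cf_spec, cf_spec]
  unfold uv
  ring

theorem three_site (c d : Fin 6 → Site → ℝ)
    (hc : ∀ i, ∑ p, ∑ q, ∑ r, Pr i p * Pr i q * Pr i r * fF c p q r = 0)
    (hd : ∀ i, ∑ p, ∑ q, ∑ r, Pr i p * Pr i q * Pr i r * fF d p q r = 0) :
    ∑ p, ∑ q, ∑ r, fF c p q r * fF d r q p ≤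
      ((∑ p, ∑ q, ∑ r, fF c p q r ^ 2) + ∑ p, ∑ q, ∑ r, fF d p q r ^ 2) / 4 := by
  rw [fF_inner]
  have h1 := Bf_polar (uv c) (uv d) (fun i => by rw [← fF_constraint]; exact hc i)
    (fun i => by rw [← fF_constraint]; exact hd i)
  have h2 := fF_norm c
  have h3 := fF_norm d
  linarith

end ThreeSite

section Overlap

variable {n : ℕ}

abbrev Idx (n : ℕ) := Fin 3 → Fin n → Fin 2

/-- overwrite three sites -/
def ow (A B C : Fin n) (x : Idx n) (u v w : Fin 3 → Fin 2) : Idx n :=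
  fun a k => if k = A then u a else if k = B then v a else if k = C then w a else x a k

def ow2 (A B C : Fin n) (z : Idx n × Idx n) (p q r : Site) : Idx n × Idx n :=
  (ow A B C z.1 p.1 q.1 r.1, ow A B C z.2 p.2 q.2 r.2)

/-- the values at one site -/
def sat (A : Fin n) (z : Idx n × Idx n) : Site := (fun a => z.1 a A, fun a => z.2 a A)

theorem ow2_ow2 (A B C : Fin n) (z : Idx n × Idx n) (p q r p1 q1 r1 : Site) :
    ow2 A B C (ow2 A B C z p q r) p1 q1 r1 = ow2 A B C z p1 q1 r1 := by
  refine Prod.ext ?_ ?_ <;> funext a k <;> simp only [ow2, ow] <;> split_ifs <;> rfl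

theorem ow2_sat (A B C : Fin n) (z : Idx n × Idx n) :
    ow2 A B C z (sat A z) (sat B z) (sat C z) = z := by
  refine Prod.ext ?_ ?_ <;> funext a k <;> simp only [ow2, ow, sat] <;> split_ifs <;> simp_all

theorem sat_ow2_A (A B C : Fin n) (z : Idx n × Idx n) (p q r : Site) :
    sat A (ow2 A B C z p q r) = p := by
  simp [sat, ow2, ow]

theorem sat_ow2_B {A B C : Fin n} (hAB : A ≠ B) (z : Idx n × Idx n) (p q r : Site) :
    sat B (ow2 A B C z p q r) = q := by
  simp [sat, ow2, ow, hAB.symm]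

theorem sat_ow2_C {A B C : Fin n} (hAC : A ≠ C) (hBC : B ≠ C) (z : Idx n × Idx n)
    (p q r : Site) :
    sat C (ow2 A B C z p q r) = r := by
  simp [sat, ow2, ow, hAC.symm, hBC.symm]

/-- Averaging over the values at three sites. -/
theorem avg_sum {R : Type*} [CommSemiring R] {A B C : Fin n} (hAB : A ≠ B) (hBC : B ≠ C)
    (hAC : A ≠ C) (F : Idx n × Idx n → R) :
    (Fintype.card (Site × Site × Site) : R) * ∑ z, F z
      = ∑ z, ∑ p, ∑ q, ∑ r, F (ow2 A B C z p q r) := by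
  let φ : (Idx n × Idx n) × (Site × Site × Site) → (Idx n × Idx n) × (Site × Site × Site) :=
    fun t => (ow2 A B C t.1 t.2.1 t.2.2.1 t.2.2.2, (sat A t.1, sat B t.1, sat C t.1))
  have hφ : Function.Involutive φ := by
    rintro ⟨z, p, q, r⟩
    simp only [φ]
    rw [ow2_ow2, ow2_sat, sat_ow2_A, sat_ow2_B hAB, sat_ow2_C hAC hBC]
  have h1 := Equiv.sum_comp hφ.toPerm (fun t => F t.1)
  have h2 : ∑ t : (Idx n × Idx n) × (Site × Site × Site), F t.1
      = (Fintype.card (Site × Site × Site) : R) * ∑ z, F z := by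
    rw [Fintype.sum_prod_type]
    simp only [Finset.sum_const, Finset.card_univ, nsmul_eq_mul]
    rw [Finset.mul_sum]
  rw [← h2, ← h1, Fintype.sum_prod_type]
  refine Finset.sum_congr rfl fun z _ => ?_
  rw [Fintype.sum_prod_type]
  refine Finset.sum_congr rfl fun p _ => ?_
  rw [Fintype.sum_prod_type]
  rfl

theorem perm6_inj : ∀ i, Function.Injective (perm6 i) := by decide

theorem perm6_inj2 : Function.Injective perm6 := by decide

noncomputable def sg (i : Fin 6) : Equiv.Perm (Fin 3) :=
  Equiv.ofBijective (perm6 i) (Finite.injective_iff_bijective.1 (perm6_inj i))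

theorem sg_apply (i : Fin 6) (a : Fin 3) : sg i a = perm6 i a := rfl

theorem sg_bij : Function.Bijective sg := by
  rw [Fintype.bijective_iff_injective_and_card]
  refine ⟨fun i j h => perm6_inj2 (funext fun a => ?_), by simp [Fintype.card_perm]; decide⟩
  rw [← sg_apply, ← sg_apply, h]

theorem sum_perm {R : Type*} [AddCommMonoid R] (f : Equiv.Perm (Fin 3) → R) :
    ∑ π, f π = ∑ i, f (sg i) := (Equiv.sum_comp (Equiv.ofBijective sg sg_bij) f).symm

theorem Pr_ite (i : Fin 6) (s : Site) :
    Pr i s = if ∀ a, s.1 a = s.2 (sg i a) then 1 else 0 := by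
  by_cases h : ∀ a, s.1 a = s.2 (sg i a)
  · have h1 : ∀ a, s.1 a = s.2 (perm6 i a) := h
    rw [if_pos h, Pr, Pz, if_pos h1]; simp
  · have h1 : ¬ ∀ a, s.1 a = s.2 (perm6 i a) := h
    rw [if_neg h, Pr, Pz, if_neg h1]; simp

theorem match_iff (i j : Fin n) (x y : Idx n) (m : Fin 6) :
    (rst3 i j x = rst3 i j y ∘ sg m) ↔
      (∀ a, (sat i (x, y)).1 a = (sat i (x, y)).2 (sg m a)) ∧
        (∀ a, (sat j (x, y)).1 a = (sat j (x, y)).2 (sg m a)) := by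
  simp only [funext_iff, rst3, rst, sat, Function.comp, Prod.mk.injEq]
  exact forall_and

theorem struct_sum {i j : Fin n} {X : Matrix (Idx n) (Idx n) ℂ}
    {c} (hX : Struct i j X c) (L : ℂ →ₗ[ℝ] ℝ) (z : Idx n × Idx n) :
    L (X z.1 z.2) = ∑ m, Pr m (sat i z) * Pr m (sat j z) * L (c (sg m) z.1 z.2) := by
  rw [hX.2, sum_perm, map_sum]
  refine Finset.sum_congr rfl fun m _ => ?_
  simp only [match_iff, Pr_ite]
  by_cases h1 : ∀ a, (sat i z).1 a = (sat i z).2 (sg m a)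
  · by_cases h2 : ∀ a, (sat j z).1 a = (sat j z).2 (sg m a)
    · rw [if_pos h1, if_pos h2, if_pos ⟨h1, h2⟩]; simp
    · rw [if_neg h2, if_neg (fun h => h2 h.2)]; simp
  · rw [if_neg h1, if_neg (fun h => h1 h.1)]; simp

/-- three permutation factors times an environment function -/
noncomputable def hmat (A B C : Fin n) (m : Fin 6) (S : Idx n × Idx n → ℂ) :
    Matrix (Idx n) (Idx n) ℂ :=
  Matrix.of fun x y => ((Pr m (sat A (x, y)) * Pr m (sat B (x, y)) * Pr m (sat C (x, y)) : ℝ) : ℂ)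
    * S (x, y)

theorem hmat_mem {i j k : Fin n} (hij : i ≠ j) (hik : i ≠ k) (hjk : j ≠ k) (m : Fin 6)
    (S : Idx n × Idx n → ℂ)
    (hS : ∀ x y r r1, S (mrg3 i j x r, mrg3 i j y r1) = S (x, y)) :
    matE _ (hmat i j k m S) ∈ Fij i j := by
  rw [mem_Fij_iff hij]
  refine ⟨fun π x y => if π = sg m then (Pr m (sat k (x, y)) : ℂ) * S (x, y) else 0, ?_, ?_⟩
  · intro π x y r r1
    have : sat k (mrg3 i j x r, mrg3 i j y r1) = sat k (x, y) := by
      simp [sat, mrg3, mrg, hik.symm, hjk.symm]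
    simp only [hS, this]
  · intro x y
    rw [Finset.sum_eq_single (sg m)]
    · simp only [match_iff, hmat, Matrix.of_apply, Pr_ite m (sat i (x, y)), Pr_ite m (sat j (x, y)),
        if_true]
      by_cases h1 : ∀ a, (sat i (x, y)).1 a = (sat i (x, y)).2 (sg m a)
      · by_cases h2 : ∀ a, (sat j (x, y)).1 a = (sat j (x, y)).2 (sg m a)
        · rw [if_pos h1, if_pos h2, if_pos ⟨h1, h2⟩]; simp
        · rw [if_neg h2, mul_zero, zero_mul, Complex.ofReal_zero, zero_mul]
          exact (if_neg (fun h => h2 h.2)).symm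
      · rw [if_neg h1, zero_mul, zero_mul, Complex.ofReal_zero, zero_mul]
        exact (if_neg (fun h => h1 h.1)).symm
    · intro π _ hπ
      simp [hπ]
    · simp

theorem ow_mrg3 {A B C i j : Fin n} (hi : i = A ∨ i = B ∨ i = C) (hj : j = A ∨ j = B ∨ j = C)
    (x y : Idx n) (r r1) (p q s : Site) :
    ow2 A B C (mrg3 i j x r, mrg3 i j y r1) p q s = ow2 A B C (x, y) p q s := by
  refine Prod.ext ?_ ?_ <;> funext a k <;> simp only [ow2, ow, mrg3, mrg] <;>
    split_ifs <;> first | rfl | (exfalso; subst_vars; tauto)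

theorem ortho_fiber {A B C : Fin n} (hAB : A ≠ B) (hBC : B ≠ C) (hAC : A ≠ C)
    (X : Matrix (Idx n) (Idx n) ℂ)
    (hX : matE _ X ∈ (Fij A B ⊓ Fij B C ⊓ Fij A C)ᗮ) (m : Fin 6) (z : Idx n × Idx n) :
    ∑ p, ∑ q, ∑ r, ((Pr m p * Pr m q * Pr m r : ℝ) : ℂ) *
      X (ow2 A B C z p q r).1 (ow2 A B C z p q r).2 = 0 := by
  set S : Idx n × Idx n → ℂ := fun z => ∑ p, ∑ q, ∑ r, ((Pr m p * Pr m q * Pr m r : ℝ) : ℂ) *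
      X (ow2 A B C z p q r).1 (ow2 A B C z p q r).2 with hS
  have hSow : ∀ z p q r, S (ow2 A B C z p q r) = S z := by
    intro z p q r
    simp only [hS, ow2_ow2]
  have hSm : ∀ i j, (i = A ∨ i = B ∨ i = C) → (j = A ∨ j = B ∨ j = C) →
      ∀ x y r r1, S (mrg3 i j x r, mrg3 i j y r1) = S (x, y) := by
    intro i j hi hj x y r r1
    simp only [hS, ow_mrg3 hi hj]
  have e1 : hmat A B C m S = hmat B C A m S := by
    ext x y; simp only [hmat, Matrix.of_apply]; push_cast; ring
  have e2 : hmat A B C m S = hmat A C B m S := by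
    ext x y; simp only [hmat, Matrix.of_apply]; push_cast; ring
  have hmem : matE _ (hmat A B C m S) ∈ Fij A B ⊓ Fij B C ⊓ Fij A C := by
    refine ⟨⟨hmat_mem hAB hAC hBC m S (hSm _ _ (by simp) (by simp)), ?_⟩, ?_⟩
    · rw [e1]; exact hmat_mem hBC hAB.symm hAC.symm m S (hSm _ _ (by simp) (by simp))
    · rw [e2]; exact hmat_mem hAC hAB hBC.symm m S (hSm _ _ (by simp) (by simp))
  have h0 : inner ℂ (matE _ (hmat A B C m S)) (matE _ X) = (0 : ℂ) := hX _ hmem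
  rw [inner_matE, ← Fintype.sum_prod_type'] at h0
  have h1 := avg_sum hAB hBC hAC
    (fun z : Idx n × Idx n => star (hmat A B C m S z.1 z.2) * X z.1 z.2)
  rw [h0, mul_zero] at h1
  have h2 : ∑ z, star (S z) * S z = 0 := by
    rw [h1]
    refine Finset.sum_congr rfl fun z _ => ?_
    conv_lhs => rw [hS]
    simp only [Finset.mul_sum]
    refine Finset.sum_congr rfl fun p _ => Finset.sum_congr rfl fun q _ =>
      Finset.sum_congr rfl fun r _ => ?_
    simp only [hmat, Matrix.of_apply, Prod.mk.eta, sat_ow2_A, sat_ow2_B hAB, sat_ow2_C hAC hBC,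
      hSow, star_mul']
    rw [Complex.star_def, Complex.conj_ofReal]
    simp only [hS]
    ring
  have h3 : ∑ z, Complex.normSq (S z) = 0 := by
    have : ((∑ z, Complex.normSq (S z) : ℝ) : ℂ) = 0 := by
      rw [← h2]; push_cast
      exact Finset.sum_congr rfl fun z _ => Complex.normSq_eq_conj_mul_self
    exact_mod_cast this
  rw [Finset.sum_eq_zero_iff_of_nonneg (fun z _ => Complex.normSq_nonneg _)] at h3
  exact Complex.normSq_eq_zero.1 (h3 z (Finset.mem_univ _))

theorem overlap_fiber {A B C : Fin n} (hAB : A ≠ B) (hBC : B ≠ C) (hAC : A ≠ C)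
    (X Y : Matrix (Idx n) (Idx n) ℂ) (c d) (hXs : Struct A B X c) (hYs : Struct B C Y d)
    (hX : matE _ X ∈ (Fij A B ⊓ Fij B C ⊓ Fij A C)ᗮ)
    (hY : matE _ Y ∈ (Fij A B ⊓ Fij B C ⊓ Fij A C)ᗮ) (L : ℂ →ₗ[ℝ] ℝ)
    (z : Idx n × Idx n) :
    ∑ p, ∑ q, ∑ r, L (X (ow2 A B C z p q r).1 (ow2 A B C z p q r).2) *
        L (Y (ow2 A B C z p q r).1 (ow2 A B C z p q r).2) ≤
      ((∑ p, ∑ q, ∑ r, L (X (ow2 A B C z p q r).1 (ow2 A B C z p q r).2) ^ 2) +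
        ∑ p, ∑ q, ∑ r, L (Y (ow2 A B C z p q r).1 (ow2 A B C z p q r).2) ^ 2) / 4 := by
  set c1 : Fin 6 → Site → ℝ := fun m s =>
    L (c (sg m) (ow2 A B C z (sat A z) (sat B z) s).1 (ow2 A B C z (sat A z) (sat B z) s).2)
    with hc1
  set d1 : Fin 6 → Site → ℝ := fun m s =>
    L (d (sg m) (ow2 A B C z s (sat B z) (sat C z)).1 (ow2 A B C z s (sat B z) (sat C z)).2)
    with hd1
  have owAB : ∀ (x : Idx n) (u v w u1 v1 : Fin 3 → Fin 2),
      ow A B C x u v w = mrg3 A B (ow A B C x u1 v1 w) (fun a => (u a, v a)) := by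
    intro x u v w u1 v1
    funext a k
    simp only [ow, mrg3, mrg]
    split_ifs <;> rfl
  have owBC : ∀ (x : Idx n) (u v w v1 w1 : Fin 3 → Fin 2),
      ow A B C x u v w = mrg3 B C (ow A B C x u v1 w1) (fun a => (v a, w a)) := by
    intro x u v w u1 v1
    funext a k
    simp only [ow, mrg3, mrg]
    split_ifs <;> first | rfl | (exfalso; subst_vars; tauto)
  have hfc : ∀ p q r, L (X (ow2 A B C z p q r).1 (ow2 A B C z p q r).2) = fF c1 p q r := by
    intro p q r
    rw [struct_sum hXs, sat_ow2_A, sat_ow2_B hAB, fF]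
    refine Finset.sum_congr rfl fun m _ => ?_
    congr 2
    simp only [ow2]
    rw [owAB z.1 p.1 q.1 r.1 (sat A z).1 (sat B z).1, owAB z.2 p.2 q.2 r.2 (sat A z).2 (sat B z).2,
      hXs.1]
  have hfd : ∀ p q r, L (Y (ow2 A B C z p q r).1 (ow2 A B C z p q r).2) = fF d1 r q p := by
    intro p q r
    rw [struct_sum hYs, sat_ow2_C hAC hBC, sat_ow2_B hAB, fF]
    refine Finset.sum_congr rfl fun m _ => ?_
    rw [mul_comm (Pr m q)]
    congr 2
    simp only [ow2]
    rw [owBC z.1 p.1 q.1 r.1 (sat B z).1 (sat C z).1, owBC z.2 p.2 q.2 r.2 (sat B z).2 (sat C z).2,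
      hYs.1]
  have swap : ∀ G : Site → Site → Site → ℝ,
      ∑ p, ∑ q, ∑ r, G r q p = ∑ p, ∑ q, ∑ r, G p q r := by
    intro G
    rw [Finset.sum_comm]
    rw [Finset.sum_congr rfl fun q _ => Finset.sum_comm]
    rw [Finset.sum_comm]
  have hreal : ∀ (W : Matrix (Idx n) (Idx n) ℂ), matE _ W ∈ (Fij A B ⊓ Fij B C ⊓ Fij A C)ᗮ →
      ∀ m, ∑ p, ∑ q, ∑ r, Pr m p * Pr m q * Pr m r *
        L (W (ow2 A B C z p q r).1 (ow2 A B C z p q r).2) = 0 := by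
    intro W hW m
    have h := congrArg L (ortho_fiber hAB hBC hAC W hW m z)
    simp only [map_sum, map_zero] at h
    rw [← h]
    refine Finset.sum_congr rfl fun p _ => Finset.sum_congr rfl fun q _ =>
      Finset.sum_congr rfl fun r _ => ?_
    rw [← Complex.real_smul, map_smul, smul_eq_mul]
  have hc0 := hreal X hX
  have hd0 := hreal Y hY
  simp only [hfc, hfd] at hc0 hd0 ⊢
  rw [swap fun p q r => fF d1 p q r ^ 2]
  refine three_site c1 d1 hc0 fun m => ?_
  rw [← hd0 m, ← swap]
  refine Finset.sum_congr rfl fun p _ => Finset.sum_congr rfl fun q _ =>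
      Finset.sum_congr rfl fun r _ => ?_
  ring

theorem overlap_L {A B C : Fin n} (hAB : A ≠ B) (hBC : B ≠ C) (hAC : A ≠ C)
    (X Y : Matrix (Idx n) (Idx n) ℂ) (c d) (hXs : Struct A B X c) (hYs : Struct B C Y d)
    (hX : matE _ X ∈ (Fij A B ⊓ Fij B C ⊓ Fij A C)ᗮ)
    (hY : matE _ Y ∈ (Fij A B ⊓ Fij B C ⊓ Fij A C)ᗮ) (L : ℂ →ₗ[ℝ] ℝ) :
    ∑ z : Idx n × Idx n, L (X z.1 z.2) * L (Y z.1 z.2) ≤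
      (∑ z : Idx n × Idx n, L (X z.1 z.2) ^ 2 + ∑ z : Idx n × Idx n, L (Y z.1 z.2) ^ 2) / 4 := by
  have hN : (0 : ℝ) < (Fintype.card (Site × Site × Site) : ℝ) := by
    exact_mod_cast Fintype.card_pos
  refine le_of_mul_le_mul_left ?_ hN
  rw [← mul_div_assoc, mul_add]
  rw [avg_sum hAB hBC hAC (fun z => L (X z.1 z.2) * L (Y z.1 z.2)),
    avg_sum hAB hBC hAC (fun z => L (X z.1 z.2) ^ 2),
    avg_sum hAB hBC hAC (fun z => L (Y z.1 z.2) ^ 2), ← Finset.sum_add_distrib, Finset.sum_div]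
  exact Finset.sum_le_sum fun z _ => overlap_fiber hAB hBC hAC X Y c d hXs hYs hX hY L z

theorem normSq_matE (X : Matrix (Idx n) (Idx n) ℂ) :
    ‖matE _ X‖ ^ 2 = ∑ z : Idx n × Idx n, (X z.1 z.2).re ^ 2 +
      ∑ z : Idx n × Idx n, (X z.1 z.2).im ^ 2 := by
  rw [EuclideanSpace.norm_sq_eq, ← Finset.sum_add_distrib]
  refine Finset.sum_congr rfl fun z _ => ?_
  rw [matE_apply, Complex.sq_norm, Complex.normSq_apply]
  ring

theorem overlap_main {A B C : Fin n} (hAB : A ≠ B) (hBC : B ≠ C) (hAC : A ≠ C)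
    (a b : EuclideanSpace ℂ (Idx n × Idx n)) (ha : a ∈ Fij A B) (hb : b ∈ Fij B C)
    (ha0 : a ∈ (Fij A B ⊓ Fij B C ⊓ Fij A C)ᗮ)
    (hb0 : b ∈ (Fij A B ⊓ Fij B C ⊓ Fij A C)ᗮ) :
    RCLike.re (inner ℂ a b) ≤ (‖a‖ ^ 2 + ‖b‖ ^ 2) / 4 := by
  obtain ⟨X, rfl⟩ := (matE (Idx n)).surjective a
  obtain ⟨Y, rfl⟩ := (matE (Idx n)).surjective b
  obtain ⟨c, hc⟩ := struct_of_mem hAB X ha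
  obtain ⟨d, hd⟩ := struct_of_mem hBC Y hb
  have h1 := overlap_L hAB hBC hAC X Y c d hc hd ha0 hb0 Complex.reLm
  have h2 := overlap_L hAB hBC hAC X Y c d hc hd ha0 hb0 Complex.imLm
  simp only [Complex.reLm_coe, Complex.imLm_coe] at h1 h2
  have h3 : RCLike.re (inner ℂ (matE (Idx n) X) (matE (Idx n) Y)) =
      ∑ z : Idx n × Idx n, (X z.1 z.2).re * (Y z.1 z.2).re +
      ∑ z : Idx n × Idx n, (X z.1 z.2).im * (Y z.1 z.2).im := by
    rw [inner_matE, ← Fintype.sum_prod_type', map_sum, ← Finset.sum_add_distrib]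
    refine Finset.sum_congr rfl fun z _ => ?_
    simp
  rw [h3, normSq_matE, normSq_matE]
  linarith

theorem Fij_symm {i j : Fin n} (h : i ≠ j) : (Fij i j : Submodule ℂ _) ≤ Fij j i := by
  intro v hv
  obtain ⟨X, rfl⟩ := (matE (Idx n)).surjective v
  obtain ⟨c, hc⟩ := struct_of_mem h X hv
  rw [mem_Fij_iff h.symm]
  have hm : ∀ (x : Idx n) (r : Fin 3 → Fin 2 × Fin 2),
      mrg3 j i x r = mrg3 i j x (fun a => (r a).swap) := by
    intro x r
    funext a k
    simp only [mrg3, mrg, Prod.fst_swap, Prod.snd_swap]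
    split_ifs <;> first | rfl | (exfalso; subst_vars; tauto)
  refine ⟨c, ?_, ?_⟩
  · intro π x y r r1
    rw [hm, hm, hc.1]
  · intro x y
    rw [hc.2]
    refine Finset.sum_congr rfl fun π _ => ?_
    congr 1
    simp only [funext_iff, rst3, rst, Function.comp, Prod.mk.injEq]
    exact propext (forall_congr' fun a => and_comm)

end Overlap

section Global

variable {n : ℕ}

theorem pairGate_subst {i j : Fin n} (h : i ≠ j) (f : Fin 2 × Fin 2 → Fin 2 × Fin 2) :
    pairGate n i j (subst f) = subst (fun x => mrg i j x (f (rst i j x))) := by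
  ext x y
  rw [pairGate_apply]
  simp only [subst]
  by_cases hx : x = mrg i j y (f (rst i j y))
  · rw [if_pos hx, if_pos, if_pos, mul_one]
    · rw [hx]; exact agr_mrg _ _ _ _
    · rw [hx, rst_mrg h]
  · rw [if_neg hx]
    by_cases h1 : rst i j x = f (rst i j y)
    · rw [if_neg (c := agr i j x y), mul_zero]
      intro h2
      apply hx
      rw [← h1, mrg_eq_of_agr (agr_symm h2)]
    · rw [if_neg h1, zero_mul]

theorem mem_FH_of_forall (hn : 3 ≤ n)
    (X : Matrix (Fin 3 → Fin n → Fin 2) (Fin 3 → Fin n → Fin 2) ℂ)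
    (hX : ∀ i j, i ≠ j → matE _ X ∈ Fij i j) (V : Matrix (Fin n → Fin 2) (Fin n → Fin 2) ℂ) :
    tensorPow 3 V * X = X * tensorPow 3 V := by
  have hloc : ∀ i j : Fin n, i ≠ j → ∀ f : Fin 2 × Fin 2 → Fin 2 × Fin 2,
      Pfun X (fun x => mrg i j x (f (rst i j x))) := by
    intro i j hij f
    obtain ⟨c, hc⟩ := struct_of_mem hij X (hX i j hij)
    rw [Pfun_iff, ← pairGate_subst hij]
    exact mem_of_struct hij X c hc _
  have hsup : ∀ i j : Fin n, i ≠ j → ∀ w z, X w z ≠ 0 →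
      ∃ π : Equiv.Perm (Fin 3), rst3 i j w = rst3 i j z ∘ π := by
    intro i j hij w z hne
    obtain ⟨c, hc⟩ := struct_of_mem hij X (hX i j hij)
    by_contra! hcon
    apply hne
    rw [hc.2]
    exact Finset.sum_eq_zero fun π _ => if_neg (hcon π)
  let s0 : Fin n := ⟨0, by omega⟩
  let s1 : Fin n := ⟨1, by omega⟩
  have h01 : s0 ≠ s1 := by simp [s0, s1]
  let b : Fin 3 → Fin n → Fin 2 := fun a k =>
    if (a = 1 ∧ k = s0) ∨ (a = 2 ∧ k = s1) then 1 else 0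
  have hb0 : ∀ a k, k ≠ s0 → k ≠ s1 → b a k = 0 := by
    intro a k h1 h2
    simp [b, h1, h2]
  have bs0 : ∀ a, b a s0 = if a = 1 then 1 else 0 := by
    intro a; simp [b, h01]
  have bs1 : ∀ a, b a s1 = if a = 2 then 1 else 0 := by
    intro a; simp [b, h01.symm]
  have hinj : Function.Injective b := by
    intro a a' h
    have e0 := congrFun h s0
    have e1 := congrFun h s1
    rw [bs0, bs0] at e0
    rw [bs1, bs1] at e1
    have hdec : ∀ a a' : Fin 3, ((if a = 1 then (1 : Fin 2) else 0) = if a' = 1 then 1 else 0) →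
        ((if a = 2 then (1 : Fin 2) else 0) = if a' = 2 then 1 else 0) → a = a' := by decide
    exact hdec a a' e0 e1
  refine perm_commutes X (fun π => X (b ∘ π) b) (sw_generic X b hinj ?_ ?_) V
  · intro w hw
    obtain ⟨π, hπ⟩ := hsup s0 s1 h01 w b hw
    refine ⟨π, ?_⟩
    funext a k
    have ha := congrFun hπ a
    simp only [rst3, rst, Function.comp, Prod.mk.injEq] at ha
    by_cases h1 : k = s0
    · rw [h1]; exact ha.1
    by_cases h2 : k = s1
    · rw [h2]; exact ha.2
    obtain ⟨π', hπ'⟩ := hsup s0 k (Ne.symm h1) w b hw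
    have ha' := congrFun hπ' a
    simp only [rst3, rst, Function.comp, Prod.mk.injEq] at ha'
    rw [ha'.2, hb0 _ _ h1 h2, Function.comp, hb0 _ _ h1 h2]
  · intro z
    have key : ∀ T : Finset (Fin n), s0 ∉ T → s1 ∉ T → ∃ f, Pfun X f ∧
        ∀ a k, f (b a) k = if k ∈ T then z a k else b a k := by
      intro T
      induction T using Finset.induction_on with
      | empty =>
        intro _ _
        refine ⟨_, hloc s0 s1 h01 id, ?_⟩
        intro a k
        simp [mrg_rst]
      | insert m T hm ih =>
        intro h0 h1
        rw [Finset.mem_insert, not_or] at h0 h1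
        obtain ⟨f, hf, hfb⟩ := ih h0.2 h1.2
        have hg1 := hloc s0 m h0.1 (fun q => (q.1, q.2 + (z 0 m + (z 1 m - z 0 m) * q.1)))
        have hg2 := hloc s1 m h1.1 (fun q => (q.1, q.2 + ((z 2 m - z 0 m) * q.1)))
        refine ⟨_, (hg2.comp hg1).comp hf, ?_⟩
        intro a k
        have e0 := hfb a s0
        have e1 := hfb a s1
        have em := hfb a m
        rw [if_neg h0.2, bs0] at e0
        rw [if_neg h1.2, bs1] at e1
        rw [if_neg hm, hb0 _ _ (Ne.symm h0.1) (Ne.symm h1.1)] at em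
        by_cases hk : k = m
        · subst hk
          simp only [Function.comp, mrg, rst, if_neg (Ne.symm h0.1), if_neg (Ne.symm h1.1), if_true,
            Finset.mem_insert_self, if_neg h01.symm, if_neg h1.1]
          rw [e0, e1, em]
          generalize z = y
          fin_cases a <;> simp
        · simp only [Function.comp, mrg, rst, Finset.mem_insert, hk, false_or, if_false]
          rw [← hfb a k]
          split_ifs <;> simp_all
    obtain ⟨f, hf, hfb⟩ := key (Finset.univ \ {s0, s1}) (by simp) (by simp)
    refine ⟨_, (hloc s0 s1 h01 (fun q => if q = (0,0) then rst s0 s1 (z 0) else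
      if q = (1,0) then rst s0 s1 (z 1) else rst s0 s1 (z 2))).comp hf, ?_⟩
    funext a k
    have e0 := hfb a s0
    have e1 := hfb a s1
    rw [if_neg (by simp), bs0] at e0
    rw [if_neg (by simp), bs1] at e1
    have hr : rst s0 s1 (f (b a)) = (if a = 1 then 1 else 0, if a = 2 then 1 else 0) := by
      simp only [rst, e0, e1]
    simp only [Function.comp]
    rw [hr]
    have hval : (if ((if a = 1 then 1 else 0, if a = 2 then 1 else 0) : Fin 2 × Fin 2) = (0,0)
      then rst s0 s1 (z 0) else
      if ((if a = 1 then 1 else 0, if a = 2 then 1 else 0) : Fin 2 × Fin 2) = (1,0)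
      then rst s0 s1 (z 1) else rst s0 s1 (z 2)) = rst s0 s1 (z a) := by
      fin_cases a <;> simp
    rw [hval]
    simp only [mrg, rst]
    split_ifs with h1 h2
    · rw [h1]
    · rw [h2]
    · rw [hfb, if_pos]
      simp [h1, h2]

end Global

section Assemble

variable {n : ℕ}

/-- The commutant of the third tensor powers of the full unitary group. -/
noncomputable def FHaar (n : ℕ) : Submodule ℂ (EuclideanSpace ℂ (Idx n × Idx n)) :=
  commE (Set.range fun V : Matrix.unitaryGroup (Fin n → Fin 2) ℂ =>
    tensorPow 3 (V : Matrix (Fin n → Fin 2) (Fin n → Fin 2) ℂ))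

theorem range_star (i j : Fin n) :
    ∀ A ∈ Set.range (fun U : Matrix.unitaryGroup (Fin 2 × Fin 2) ℂ =>
      tensorPow 3 (pairGate n i j (U : Matrix (Fin 2 × Fin 2) (Fin 2 × Fin 2) ℂ))),
      Aᴴ ∈ Set.range (fun U : Matrix.unitaryGroup (Fin 2 × Fin 2) ℂ =>
      tensorPow 3 (pairGate n i j (U : Matrix (Fin 2 × Fin 2) (Fin 2 × Fin 2) ℂ))) := by
  rintro _ ⟨U, rfl⟩
  refine ⟨star U, ?_⟩
  change tensorPow 3 (pairGate n i j ((U : Matrix (Fin 2 × Fin 2) (Fin 2 × Fin 2) ℂ)ᴴ)) = _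
  rw [pairGate_conjTranspose, tensorPow_conjTranspose]

theorem Fij_comm {i j k l : Fin n} (hij : i ≠ j) (hkl : k ≠ l) (hik : i ≠ k) (hil : i ≠ l)
    (hjk : j ≠ k) (hjl : j ≠ l) (x : EuclideanSpace ℂ (Idx n × Idx n)) :
    (Fij i j).starProjection ((Fij k l).starProjection x)
      = (Fij k l).starProjection ((Fij i j).starProjection x) := by
  apply proj_comm _ _ (range_star i j) _ (range_star k l)
  rintro _ ⟨U, rfl⟩ _ ⟨V, rfl⟩
  rw [← tensorPow_mul, ← tensorPow_mul, pairGate_comm hij hkl hik hil hjk hjl]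

theorem FHaar_le {i j : Fin n} (hij : i ≠ j) : FHaar n ≤ Fij i j := by
  intro v hv
  obtain ⟨X, rfl⟩ := (matE (Idx n)).surjective v
  rw [FHaar, mem_commE] at hv
  rw [mem_Fij]
  intro U hU
  exact hv _ ⟨⟨pairGate n i j U, pairGate_unitary hij hU⟩, rfl⟩

theorem mem_FHaar (hn : 3 ≤ n) (v : EuclideanSpace ℂ (Idx n × Idx n))
    (h : ∀ i j, i ≠ j → v ∈ Fij i j) : v ∈ FHaar n := by
  obtain ⟨X, rfl⟩ := (matE (Idx n)).surjective v
  rw [FHaar, mem_commE]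
  rintro _ ⟨V, rfl⟩
  exact mem_FH_of_forall hn X h _

theorem haarStep_eq (μH : Measure (Matrix.unitaryGroup (Fin n → Fin 2) ℂ))
    [μH.IsHaarMeasure] [IsProbabilityMeasure μH] (X : Matrix (Idx n) (Idx n) ℂ) :
    matE _ (haarStep n μH X) = (FHaar n).starProjection (matE _ X) := by
  exact average_eq_proj μH (fun V : Matrix.unitaryGroup (Fin n → Fin 2) ℂ =>
    tensorPow 3 (V : Matrix (Fin n → Fin 2) (Fin n → Fin 2) ℂ))
    (fun g h => tensorPow_mul 3 _ _) (fun g => tensorPow_unitary 3 g.2)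
    ((tensorPow_continuous 3).comp continuous_subtype_val) X

theorem pairStep_eq {i j : Fin n} (hij : i ≠ j)
    (μ : Measure (Matrix.unitaryGroup (Fin 2 × Fin 2) ℂ))
    [μ.IsHaarMeasure] [IsProbabilityMeasure μ] (X : Matrix (Idx n) (Idx n) ℂ) :
    matE (Idx n) (Matrix.of fun x y => ∫ U : Matrix.unitaryGroup (Fin 2 × Fin 2) ℂ,
        (tensorPow 3 (pairGate n i j (U : Matrix (Fin 2 × Fin 2) (Fin 2 × Fin 2) ℂ)) * X *
          (tensorPow 3
            (pairGate n i j (U : Matrix (Fin 2 × Fin 2) (Fin 2 × Fin 2) ℂ)))ᴴ) x y ∂μ)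
      = (Fij i j).starProjection (matE _ X) := by
  refine average_eq_proj μ (fun U : Matrix.unitaryGroup (Fin 2 × Fin 2) ℂ =>
    tensorPow 3 (pairGate n i j (U : Matrix (Fin 2 × Fin 2) (Fin 2 × Fin 2) ℂ)))
    (fun g h => ?_) (fun g => tensorPow_unitary 3 (pairGate_unitary hij g.2))
    ((tensorPow_continuous 3).comp ((pairGate_continuous i j).comp continuous_subtype_val)) X
  rw [← tensorPow_mul, ← pairGate_mul hij]
  rfl

theorem uniformStep_eq (μ : Measure (Matrix.unitaryGroup (Fin 2 × Fin 2) ℂ))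
    [μ.IsHaarMeasure] [IsProbabilityMeasure μ] (X : Matrix (Idx n) (Idx n) ℂ) :
    matE _ (uniformStep n μ X) = (n.choose 2 : ℂ)⁻¹ •
      ∑ p ∈ Finset.univ.filter (fun p : Fin n × Fin n => p.1 < p.2),
        (Fij p.1 p.2).starProjection (matE _ X) := by
  rw [← Finset.sum_congr rfl fun p hp => pairStep_eq (ne_of_lt (Finset.mem_filter.1 hp).2) μ X]
  rw [← map_sum, ← map_smul]
  congr 1
  ext x y
  rw [Matrix.smul_apply, Matrix.sum_apply]
  rfl

end Assemble


/-- Uniform random quantum circuits converge to the Haar third moment at rate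
`1 - 1/(5n²)` per step: `‖G_unif^k(X) - G_H(X)‖₂ ≤ (1 - 1/(5n²))^k ‖X‖₂` for all `k`, `X`.
Consequently, uniform random circuits of size `5n²·ln(1/ε)` are `ε`-approximate unitary
3-designs. -/
theorem uniform_random_circuit_three_design
    (n : ℕ) (hn : 3 ≤ n)
    (μ : Measure (Matrix.unitaryGroup (Fin 2 × Fin 2) ℂ))
    [μ.IsHaarMeasure] [IsProbabilityMeasure μ]
    (μH : Measure (Matrix.unitaryGroup (Fin n → Fin 2) ℂ))
    [μH.IsHaarMeasure] [IsProbabilityMeasure μH] :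
    ∀ (k : ℕ) (X : Matrix (Fin 3 → Fin n → Fin 2) (Fin 3 → Fin n → Fin 2) ℂ),
      frobNorm ((uniformStep n μ)^[k] X - haarStep n μH X) ≤
        (1 - 1 / (5 * (n : ℝ) ^ 2)) ^ k * frobNorm X := by

  intro k X
  have hsemi : Function.Semiconj (matE (Idx n)) (uniformStep n μ)
      (fun y => (n.choose 2 : ℂ)⁻¹ •
        ∑ p ∈ Finset.univ.filter (fun p : Fin n × Fin n => p.1 < p.2),
          (Fij p.1 p.2).starProjection y) := fun X => uniformStep_eq μ X
  rw [frobNorm_eq, frobNorm_eq, map_sub, haarStep_eq, (hsemi.iterate_right k).eq]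
  exact abstract_main n hn Fij (FHaar n)
    (fun i j h => le_antisymm (Fij_symm h) (Fij_symm h.symm))
    (fun i j k hij hjk hik a ha b hb ha0 hb0 => overlap_main hij hjk hik a b ha hb ha0 hb0)
    (fun i j k l hij hkl hik hil hjk hjl x => Fij_comm hij hkl hik hil hjk hjl x)
    (fun i j h => FHaar_le h) (fun x hx => mem_FHaar hn x hx) k (matE (Idx n) X)
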